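/- arXiv:2010.07766 — 2 statements merged into one kernel-verified Lean document; each statement's English description precedes it below -/
import Mathlib

section
/- As x → ∞, the quantity (ln x)² · ∏_{p prime, 3 ≤ p < x} (p−2)/p converges to 4·e^{−2γ}·C₂, where γ is the Euler–Mascheroni constant and C₂ = ∏_{p prime, p ≥ 3} p(p−2)/(p−1)² is the twin prime constant. -/
open Filter

/-- The twin prime constant `C₂ = ∏_{p prime, p ≥ 3} p(p−2)/(p−1)²`. -/
noncomputable def twinPrimeConstant : ℝ :=
  ∏' p : ℕ, if p.Prime ∧ p ≠ 2 then (p : ℝ) * ((p : ℝ) - 2) / ((p : ℝ) - 1) ^ 2 else 1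

namespace TPC

/-- weight `log p / p` on primes -/
noncomputable def lp (n : ℕ) : ℝ := if n.Prime then Real.log n / n else 0

/-- weight `-log (1 - 1/p)` on primes -/
noncomputable def tt (n : ℕ) : ℝ := if n.Prime then -Real.log (1 - (n : ℝ)⁻¹) else 0

lemma log_factorial_eq (N : ℕ) : Real.log (N.factorial : ℝ) =
    ∑ p ∈ N.primesLE, (N.factorial.factorization p : ℝ) * Real.log p := by
  have h := Nat.prod_factorization_pow_eq_self (Nat.factorial_ne_zero N)
  rw [Finsupp.prod_of_support_subset (s := N.primesLE)] at h
  · conv_lhs => rw [← h]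
    push_cast
    rw [Real.log_prod]
    · refine Finset.sum_congr rfl fun p _ => ?_
      rw [Real.log_pow]
    · intro p hp
      have : p.Prime := (Nat.mem_primesLE.1 hp).2
      exact pow_ne_zero _ (by exact_mod_cast this.ne_zero)
  · intro p hp
    have h1 := Nat.support_factorization N.factorial ▸ hp
    rw [Nat.mem_primeFactors] at h1
    exact Nat.mem_primesLE.2 ⟨(h1.1.dvd_factorial).1 h1.2.1, h1.1⟩
  · intro i _
    simp

lemma fact_lower {p N : ℕ} (hp : p.Prime) : (N : ℝ) / p - 1 ≤ (N.factorial.factorization p : ℝ) := by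
  have h1 : N / p ≤ N.factorial.factorization p := by
    rw [Nat.factorization_factorial hp (b := Nat.log p N + 2) (by omega)]
    have := Finset.single_le_sum (f := fun i => N / p ^ i) (s := Finset.Ico 1 (Nat.log p N + 2))
      (fun _ _ => Nat.zero_le _) (a := 1) (by simp)
    simpa using this
  have h2 : (N : ℝ) / p < (N / p : ℕ) + 1 := by
    have hp' : (0 : ℝ) < p := by exact_mod_cast hp.pos
    rw [div_lt_iff₀ hp']
    exact_mod_cast (by
      have := Nat.lt_mul_div_succ N hp.pos
      rw [mul_comm]; exact this)
  have h3 : ((N / p : ℕ) : ℝ) ≤ N.factorial.factorization p := by exact_mod_cast h1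
  linarith

lemma fact_upper {p N : ℕ} (hp : p.Prime) :
    (N.factorial.factorization p : ℝ) ≤ (N : ℝ) / (p - 1) := by
  have := Fact.mk hp
  have h := sub_one_mul_padicValNat_factorial (p := p) N
  have h1 : (p - 1) * padicValNat p N.factorial ≤ N := by omega
  rw [Nat.factorization_def _ hp]
  have hp' : (1 : ℝ) < p := by exact_mod_cast hp.one_lt
  rw [le_div_iff₀ (by linarith)]
  have : (((p - 1 : ℕ) : ℝ)) * padicValNat p N.factorial ≤ N := by exact_mod_cast h1
  rw [Nat.cast_sub hp.one_le] at this
  push_cast at this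
  linarith

lemma sum_primesLE (N : ℕ) (g : ℕ → ℝ) :
    ∑ p ∈ N.primesLE, g p = ∑ n ∈ Finset.range (N + 1), if n.Prime then g n else 0 := by
  rw [← Finset.sum_filter]
  rfl

lemma lp_upper (N : ℕ) (hN : 1 ≤ N) :
    ∑ n ∈ Finset.range (N + 1), lp n ≤ Real.log N + Real.log 4 := by
  have hN' : (0 : ℝ) < N := by exact_mod_cast hN
  have h1 : Real.log (N.factorial : ℝ) ≤ N * Real.log N := by
    rw [← Real.log_pow]
    apply Real.log_le_log (by exact_mod_cast N.factorial_pos)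
    exact_mod_cast Nat.factorial_le_pow N
  have h2 := Chebyshev.theta_le_log4_mul_x hN'.le
  rw [Chebyshev.theta_eq_sum_primesLE_log] at h2
  rw [log_factorial_eq] at h1
  have h3 : ∑ p ∈ N.primesLE, ((N : ℝ) / p - 1) * Real.log p ≤
      ∑ p ∈ N.primesLE, (N.factorial.factorization p : ℝ) * Real.log p := by
    refine Finset.sum_le_sum fun p hp => ?_
    have : p.Prime := (Nat.mem_primesLE.1 hp).2
    exact mul_le_mul_of_nonneg_right (fact_lower this) (Real.log_natCast_nonneg p)
  have h4 : ∑ p ∈ N.primesLE, ((N : ℝ) / p - 1) * Real.log p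
      = N * ∑ n ∈ Finset.range (N + 1), lp n - ∑ p ∈ N.primesLE, Real.log p := by
    unfold lp
    rw [← sum_primesLE N (fun n => Real.log n / n), Finset.mul_sum, ← Finset.sum_sub_distrib]
    refine Finset.sum_congr rfl fun p hp => ?_
    ring
  have : (N : ℝ) * ∑ n ∈ Finset.range (N + 1), lp n ≤ N * (Real.log N + Real.log 4) := by
    linarith
  exact le_of_mul_le_mul_left this hN'

lemma summable_aux : Summable (fun n : ℕ => Real.log n * (1 / ((n : ℝ) - 1) - 1 / n)) := by
  have hs : Summable (fun n : ℕ => 4 * ((n : ℝ) ^ (3 / 2 : ℝ))⁻¹) :=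
    (Real.summable_nat_rpow_inv.2 (by norm_num)).mul_left 4
  refine Summable.of_nonneg_of_le (fun n => ?_) (fun n => ?_) hs
  · rcases Nat.lt_or_ge n 2 with h | h
    · interval_cases n <;> simp
    · have : (2 : ℝ) ≤ n := by exact_mod_cast h
      refine mul_nonneg (Real.log_natCast_nonneg n) (sub_nonneg.2 ?_)
      exact one_div_le_one_div_of_le (by linarith) (by linarith)
  · rcases Nat.lt_or_ge n 2 with h | h
    · interval_cases n <;> simp
    · have h2 : (2 : ℝ) ≤ n := by exact_mod_cast h
      have h0 : (0 : ℝ) < n := by linarith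
      have hl : Real.log n ≤ 2 * (n : ℝ) ^ (1 / 2 : ℝ) := by
        have := Real.log_le_rpow_div h0.le (ε := 1 / 2) (by norm_num)
        linarith
      have he : 1 / ((n : ℝ) - 1) - 1 / n ≤ 2 * ((n : ℝ) ^ (2 : ℝ))⁻¹ := by
        rw [Real.rpow_two, div_sub_div _ _ (by linarith) (by linarith), ← div_eq_mul_inv,
          div_le_div_iff₀ (by nlinarith) (by positivity)]
        nlinarith [mul_nonneg h0.le (sub_nonneg.2 h2)]
      have he0 : 0 ≤ 1 / ((n : ℝ) - 1) - 1 / n :=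
        sub_nonneg.2 (one_div_le_one_div_of_le (by linarith) (by linarith))
      calc _ ≤ (2 * (n : ℝ) ^ (1 / 2 : ℝ)) * (2 * ((n : ℝ) ^ (2 : ℝ))⁻¹) :=
            mul_le_mul hl he he0 (by positivity)
        _ = 4 * ((n : ℝ) ^ (3 / 2 : ℝ))⁻¹ := by
            rw [← Real.rpow_neg h0.le, ← Real.rpow_neg h0.le]
            have : (n : ℝ) ^ (-(3 / 2) : ℝ) = (n : ℝ) ^ (1 / 2 : ℝ) * (n : ℝ) ^ (-2 : ℝ) := by
              rw [← Real.rpow_add h0]; norm_num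
            rw [this]; ring

lemma lp_lower : ∃ C : ℝ, ∀ N : ℕ, 1 ≤ N →
    Real.log N - C ≤ ∑ n ∈ Finset.range (N + 1), lp n := by
  refine ⟨1 + ∑' n : ℕ, Real.log n * (1 / ((n : ℝ) - 1) - 1 / n), fun N hN => ?_⟩
  have hN' : (0 : ℝ) < N := by exact_mod_cast hN
  have h1 : N * Real.log N - N ≤ Real.log (N.factorial : ℝ) := by
    have h := Real.pow_div_factorial_le_exp (N : ℝ) hN'.le N
    have hf : (0 : ℝ) < N.factorial := by exact_mod_cast N.factorial_pos
    have h' := Real.log_le_log (by positivity) h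
    rw [Real.log_exp, Real.log_div (by positivity) hf.ne', Real.log_pow] at h'
    linarith
  rw [log_factorial_eq] at h1
  have h3 : ∑ p ∈ N.primesLE, (N.factorial.factorization p : ℝ) * Real.log p ≤
      ∑ p ∈ N.primesLE, ((N : ℝ) / (p - 1)) * Real.log p := by
    refine Finset.sum_le_sum fun p hp => ?_
    have : p.Prime := (Nat.mem_primesLE.1 hp).2
    exact mul_le_mul_of_nonneg_right (fact_upper this) (Real.log_natCast_nonneg p)
  have h4 : ∑ p ∈ N.primesLE, ((N : ℝ) / (p - 1)) * Real.log p
      = N * (∑ n ∈ Finset.range (N + 1), lp n +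
        ∑ p ∈ N.primesLE, Real.log p * (1 / ((p : ℝ) - 1) - 1 / p)) := by
    unfold lp
    rw [← sum_primesLE N (fun n => Real.log n / n), ← Finset.sum_add_distrib, Finset.mul_sum]
    refine Finset.sum_congr rfl fun p hp => ?_
    ring
  have h5 : ∑ p ∈ N.primesLE, Real.log p * (1 / ((p : ℝ) - 1) - 1 / p) ≤
      ∑' n : ℕ, Real.log n * (1 / ((n : ℝ) - 1) - 1 / n) := by
    refine summable_aux.sum_le_tsum _ fun n _ => ?_
    rcases Nat.lt_or_ge n 2 with h | h
    · interval_cases n <;> simp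
    · have : (2 : ℝ) ≤ n := by exact_mod_cast h
      refine mul_nonneg (Real.log_natCast_nonneg n) (sub_nonneg.2 ?_)
      exact one_div_le_one_div_of_le (by linarith) (by linarith)
  have h6 : (N : ℝ) * (Real.log N - 1) ≤ N * (∑ n ∈ Finset.range (N + 1), lp n +
        ∑ p ∈ N.primesLE, Real.log p * (1 / ((p : ℝ) - 1) - 1 / p)) := by
    linarith
  have := le_of_mul_le_mul_left h6 hN'
  linarith

lemma log_bound {z : ℝ} (h0 : 0 ≤ z) (h1 : z ≤ 1 / 2) : |-Real.log (1 - z) - z| ≤ 2 * z ^ 2 := by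
  have h := Real.abs_log_sub_add_sum_range_le (x := z) (by rw [abs_of_nonneg h0]; linarith) 1
  simp only [Finset.sum_range_one, abs_of_nonneg h0] at h
  norm_num at h
  have e : |-Real.log (1 - z) - z| = |z + Real.log (1 - z)| := by
    rw [← abs_neg]; ring_nf
  rw [e]
  refine h.trans ?_
  rw [div_le_iff₀ (by linarith)]
  nlinarith [sq_nonneg z]

lemma inv_le_half {n : ℕ} (hn : n.Prime) : (n : ℝ)⁻¹ ≤ 1 / 2 := by
  have : (2 : ℝ) ≤ n := by exact_mod_cast hn.two_le
  rw [one_div]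
  exact inv_anti₀ (by norm_num) this

lemma summable_two : Summable (fun n : ℕ => 2 * ((n : ℝ)⁻¹) ^ 2) := by
  have := (Real.summable_one_div_nat_pow (p := 2)).2 (by norm_num)
  refine (this.mul_left 2).congr fun n => ?_
  simp

lemma summable_tt_sub : Summable (fun n : ℕ => tt n - if n.Prime then (n : ℝ)⁻¹ else 0) := by
  refine Summable.of_norm_bounded summable_two fun n => ?_
  unfold tt
  split_ifs with h
  · exact log_bound (by positivity) (inv_le_half h)
  · simp

lemma sum_z (n : ℕ) : ∑ i ∈ Finset.range n, (lp (i + 2) - 1 / ((i : ℝ) + 2)) =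
    ∑ m ∈ Finset.range (n + 2), lp m - (harmonic (n + 1) - 1) := by
  induction n with
  | zero => simp [Finset.sum_range_succ, lp, harmonic]
  | succ k ih =>
    rw [Finset.sum_range_succ, ih, Finset.sum_range_succ _ (k + 2), harmonic_succ (k + 1)]
    push_cast
    rw [show (k : ℝ) + 1 + 1 = k + 2 by ring]
    ring

lemma bounded_z : ∃ C : ℝ, ∀ n : ℕ,
    ‖∑ i ∈ Finset.range n, (lp (i + 2) - 1 / ((i : ℝ) + 2))‖ ≤ C := by
  obtain ⟨C, hC⟩ := lp_lower
  refine ⟨max (Real.log 4 + 1) C, fun n => ?_⟩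
  rw [sum_z, Real.norm_eq_abs, abs_le]
  have h1 := lp_upper (n + 1) (by omega)
  have h2 := hC (n + 1) (by omega)
  have h3 := log_add_one_le_harmonic (n + 1)
  have h4 := harmonic_le_one_add_log (n + 1)
  have h5 : Real.log ((n + 1 : ℕ) : ℝ) ≤ Real.log ((n + 1 : ℕ) + 1 : ℝ) :=
    Real.log_le_log (by positivity) (by linarith)
  push_cast at *
  constructor
  · have := le_max_right (Real.log 4 + 1) C
    linarith
  · have := le_max_left (Real.log 4 + 1) C
    linarith

lemma conv_wz : ∃ c : ℝ, Tendsto (fun n : ℕ => ∑ i ∈ Finset.range n,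
    (1 / Real.log ((i : ℝ) + 2)) * (lp (i + 2) - 1 / ((i : ℝ) + 2))) atTop (nhds c) := by
  obtain ⟨C, hC⟩ := bounded_z
  have ha : Antitone (fun i : ℕ => 1 / Real.log ((i : ℝ) + 2)) := by
    intro a b hab
    have hab' : (a : ℝ) ≤ b := by exact_mod_cast hab
    have ha0 : (0 : ℝ) ≤ a := by positivity
    exact one_div_le_one_div_of_le (Real.log_pos (by linarith))
      (Real.log_le_log (by linarith) (by linarith))
  have hl : Tendsto (fun i : ℕ => 1 / Real.log ((i : ℝ) + 2)) atTop (nhds 0) := by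
    have : Tendsto (fun i : ℕ => Real.log ((i : ℝ) + 2)) atTop atTop :=
      Real.tendsto_log_atTop.comp (tendsto_atTop_add_const_right _ _ tendsto_natCast_atTop_atTop)
    simp only [one_div]
    exact this.inv_tendsto_atTop
  have := ha.cauchySeq_series_mul_of_tendsto_zero_of_bounded hl hC
  simpa using cauchySeq_tendsto_of_complete this

lemma loglog_step (n : ℕ) :
    Real.log (Real.log ((n : ℝ) + 3)) - Real.log (Real.log ((n : ℝ) + 2)) ≤
      1 / (((n : ℝ) + 2) * Real.log ((n : ℝ) + 2)) ∧
    1 / (((n : ℝ) + 3) * Real.log ((n : ℝ) + 3)) ≤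
      Real.log (Real.log ((n : ℝ) + 3)) - Real.log (Real.log ((n : ℝ) + 2)) := by
  have h0 : (0 : ℝ) ≤ n := by positivity
  have l2 : 0 < Real.log ((n : ℝ) + 2) := Real.log_pos (by linarith)
  have l3 : 0 < Real.log ((n : ℝ) + 3) := Real.log_pos (by linarith)
  rw [← Real.log_div l3.ne' l2.ne']
  have e : Real.log (((n : ℝ) + 3) / (n + 2)) = Real.log ((n : ℝ) + 3) - Real.log ((n : ℝ) + 2) :=
    Real.log_div (by linarith) (by linarith)
  have u1 := Real.log_le_sub_one_of_pos (x := ((n : ℝ) + 3) / (n + 2)) (by positivity)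
  have u2 := Real.one_sub_inv_le_log_of_pos (x := ((n : ℝ) + 3) / (n + 2)) (by positivity)
  rw [e] at u1 u2
  have v1 := Real.log_le_sub_one_of_pos (x := Real.log ((n : ℝ) + 3) / Real.log ((n : ℝ) + 2))
    (by positivity)
  have v2 := Real.one_sub_inv_le_log_of_pos
    (x := Real.log ((n : ℝ) + 3) / Real.log ((n : ℝ) + 2)) (by positivity)
  have w1 : ((n : ℝ) + 3) / (n + 2) - 1 = 1 / (n + 2) := by field_simp; ring
  have w2 : 1 - (((n : ℝ) + 3) / (n + 2))⁻¹ = 1 / (n + 3) := by field_simp; ring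
  rw [w1] at u1
  rw [w2] at u2
  constructor
  · refine v1.trans ?_
    rw [← div_div, le_div_iff₀ l2, sub_mul, div_mul_cancel₀ _ l2.ne']
    linarith
  · refine le_trans ?_ v2
    rw [← div_div, div_le_iff₀ l3, inv_div, sub_mul, div_mul_cancel₀ _ l3.ne']
    linarith

lemma summable_d : Summable (fun n : ℕ => 1 / (((n : ℝ) + 2) * Real.log ((n : ℝ) + 2)) -
    (Real.log (Real.log ((n : ℝ) + 3)) - Real.log (Real.log ((n : ℝ) + 2)))) := by
  refine summable_of_sum_range_le (c := 1 / (((0 : ℕ) + 2 : ℝ) * Real.log ((0 : ℕ) + 2 : ℝ)))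
    (fun n => by linarith [(loglog_step n).1]) (fun n => ?_)
  have h1 : ∀ i ∈ Finset.range n, 1 / (((i : ℝ) + 2) * Real.log ((i : ℝ) + 2)) -
    (Real.log (Real.log ((i : ℝ) + 3)) - Real.log (Real.log ((i : ℝ) + 2))) ≤
      (fun j : ℕ => 1 / (((j : ℝ) + 2) * Real.log ((j : ℝ) + 2))) i -
      (fun j : ℕ => 1 / (((j : ℝ) + 2) * Real.log ((j : ℝ) + 2))) (i + 1) := by
    intro i _
    have := (loglog_step i).2
    simp only
    push_cast
    rw [show (i : ℝ) + 1 + 2 = i + 3 by ring]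
    linarith
  refine (Finset.sum_le_sum h1).trans ?_
  rw [Finset.sum_range_sub']
  have : 0 ≤ 1 / (((n : ℝ) + 2) * Real.log ((n : ℝ) + 2)) := by
    have : 0 < Real.log ((n : ℝ) + 2) := Real.log_pos (by have : (0:ℝ) ≤ n := by positivity
                                                          linarith)
    positivity
  linarith

lemma mertens_exists : ∃ c : ℝ, Tendsto (fun N : ℕ => ∑ n ∈ Finset.range N, tt n -
    Real.log (Real.log N)) atTop (nhds c) := by
  obtain ⟨c1, h1⟩ := conv_wz
  have h2 := summable_d.hasSum.tendsto_sum_nat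
  have h3 := ((summable_nat_add_iff 2).2 summable_tt_sub).hasSum.tendsto_sum_nat
  have h := ((h1.add h2).add h3).sub_const (Real.log (Real.log 2))
  refine ⟨_, (tendsto_add_atTop_iff_nat 2).1 (h.congr fun n => ?_)⟩
  rw [← Finset.sum_add_distrib, ← Finset.sum_add_distrib]
  induction n with
  | zero => simp [Finset.sum_range_succ, tt]
  | succ k ih =>
    rw [Finset.sum_range_succ, show k + 1 + 2 = (k + 2) + 1 by ring,
      Finset.sum_range_succ _ (k + 2)]
    have h0 : (0 : ℝ) ≤ k := by positivity
    have l2 : 0 < Real.log ((k : ℝ) + 2) := Real.log_pos (by linarith)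
    have e1 : 1 / Real.log ((k : ℝ) + 2) * (lp (k + 2) - 1 / ((k : ℝ) + 2)) =
      (if (k + 2).Prime then (((k + 2 : ℕ)) : ℝ)⁻¹ else 0) -
        1 / (((k : ℝ) + 2) * Real.log ((k : ℝ) + 2)) := by
      unfold lp
      split_ifs with hp
      · push_cast
        field_simp
      · field_simp
        ring
    rw [e1]
    push_cast at *
    rw [show (k : ℝ) + 2 + 1 = k + 3 by ring]
    linarith

/-- weight `-log (1 - p^{-(1+δ)})` on primes -/
noncomputable def uu (δ : ℝ) (n : ℕ) : ℝ :=
  if n.Prime then -Real.log (1 - (n : ℝ)⁻¹ * (n : ℝ) ^ (-δ)) else 0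

lemma rpow_bounds {δ : ℝ} (hδ : 0 ≤ δ) {n : ℕ} (hn : n.Prime) :
    0 < (n : ℝ) ^ (-δ) ∧ (n : ℝ) ^ (-δ) ≤ 1 := by
  have h1 : (1 : ℝ) ≤ n := by exact_mod_cast hn.one_le
  exact ⟨Real.rpow_pos_of_pos (by linarith) _, Real.rpow_le_one_of_one_le_of_nonpos h1 (by linarith)⟩

lemma tt_nonneg (n : ℕ) : 0 ≤ tt n := by
  unfold tt
  split_ifs with h
  · have := inv_le_half h
    have h0 : (0 : ℝ) ≤ (n : ℝ)⁻¹ := by positivity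
    have := Real.log_nonpos (x := 1 - (n : ℝ)⁻¹) (by linarith) (by linarith)
    linarith
  · exact le_rfl

lemma tt_le (n : ℕ) : tt n ≤ 2 * (n : ℝ)⁻¹ := by
  unfold tt
  split_ifs with h
  · have h1 := inv_le_half h
    have h0 : (0 : ℝ) ≤ (n : ℝ)⁻¹ := by positivity
    have h2 := (abs_le.1 (log_bound h0 h1)).2
    nlinarith
  · positivity

lemma summable_D {δ : ℝ} (hδ : 0 < δ) : Summable (fun n : ℕ => tt n * (n : ℝ) ^ (-δ)) := by
  have hs := ((Real.summable_nat_rpow_inv (p := 1 + δ)).2 (by linarith)).mul_left 2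
  refine Summable.of_nonneg_of_le (fun n => mul_nonneg (tt_nonneg n) (by positivity))
    (fun n => ?_) hs
  rcases Nat.eq_zero_or_pos n with rfl | h
  · simp [tt]
    positivity
  · have h0 : (0 : ℝ) < n := by exact_mod_cast h
    rw [Real.rpow_add h0, Real.rpow_one, Real.rpow_neg h0.le, mul_inv, ← mul_assoc]
    exact mul_le_mul_of_nonneg_right (tt_le n) (by positivity)

lemma diff_bound {δ : ℝ} (hδ : 0 ≤ δ) (n : ℕ) :
    ‖uu δ n - tt n * (n : ℝ) ^ (-δ)‖ ≤ 4 * ((n : ℝ)⁻¹) ^ 2 := by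
  unfold uu tt
  split_ifs with h
  · obtain ⟨q0, q1⟩ := rpow_bounds hδ h
    set q := (n : ℝ) ^ (-δ)
    set y := (n : ℝ)⁻¹
    have y1 : y ≤ 1 / 2 := inv_le_half h
    have y0 : 0 ≤ y := by positivity
    have hq : y * q ≤ y := mul_le_of_le_one_right y0 q1
    have hq0 : 0 ≤ y * q := by positivity
    have b1 := log_bound hq0 (hq.trans y1)
    have b2 := log_bound y0 y1
    have e : -Real.log (1 - y * q) - -Real.log (1 - y) * q =
      (-Real.log (1 - y * q) - y * q) - (-Real.log (1 - y) - y) * q := by ring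
    rw [e, Real.norm_eq_abs]
    refine (abs_sub _ _).trans ?_
    rw [abs_mul, abs_of_pos q0]
    have b3 : |-Real.log (1 - y) - y| * q ≤ 2 * y ^ 2 :=
      (mul_le_of_le_one_right (abs_nonneg _) q1).trans b2
    have b4 : (y * q) ^ 2 ≤ y ^ 2 := pow_le_pow_left₀ hq0 hq 2
    linarith
  · simp

lemma summable_four : Summable (fun n : ℕ => 4 * ((n : ℝ)⁻¹) ^ 2) :=
  (summable_two.mul_left 2).congr fun n => by ring

lemma summable_uu {δ : ℝ} (hδ : 0 < δ) : Summable (uu δ) := by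
  have h1 : Summable (fun n => uu δ n - tt n * (n : ℝ) ^ (-δ)) :=
    Summable.of_norm_bounded summable_four (diff_bound hδ.le)
  exact (h1.add (summable_D hδ)).congr fun n => by ring

lemma diff_tendsto : Tendsto (fun δ : ℝ => ∑' n, (uu δ n - tt n * (n : ℝ) ^ (-δ)))
    (nhdsWithin 0 (Set.Ioi 0)) (nhds 0) := by
  have h := tendsto_tsum_of_dominated_convergence (𝓕 := nhdsWithin (0 : ℝ) (Set.Ioi 0))
    (f := fun δ n => uu δ n - tt n * (n : ℝ) ^ (-δ)) (g := fun _ => 0) summable_four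
    (fun n => ?_) ?_
  · simpa using h
  · refine Tendsto.mono_left ?_ nhdsWithin_le_nhds
    unfold uu tt
    split_ifs with h
    · have hn : (n : ℝ) ≠ 0 := by exact_mod_cast h.ne_zero
      have hc : Tendsto (fun δ : ℝ => (n : ℝ) ^ (-δ)) (nhds 0) (nhds 1) := by
        have : Continuous (fun δ : ℝ => (n : ℝ) ^ (-δ)) :=
          Real.continuous_const_rpow hn |>.comp continuous_neg
        simpa using this.tendsto 0
      have y1 := inv_le_half h
      have h2 : Tendsto (fun δ : ℝ => Real.log (1 - (n : ℝ)⁻¹ * (n : ℝ) ^ (-δ))) (nhds 0)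
          (nhds (Real.log (1 - (n : ℝ)⁻¹ * 1))) :=
        ((hc.const_mul _).const_sub _).log (by linarith)
      have := h2.neg.sub (hc.const_mul (-Real.log (1 - (n : ℝ)⁻¹)))
      simpa using this
    · simp
  · filter_upwards [self_mem_nhdsWithin] with δ hδ n
    exact diff_bound (le_of_lt hδ) n

lemma tsum_uu {δ : ℝ} (hδ : 0 < δ) :
    ∑' n, uu δ n = Real.log (riemannZeta ((1 + δ : ℝ) : ℂ)).re := by
  have h1 := riemannZeta_eulerProduct (s := ((1 + δ : ℝ) : ℂ)) (by simp; exact hδ)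
  have h2 := (Complex.continuous_re.tendsto _).comp h1
  have hpos : 0 < (riemannZeta ((1 + δ : ℝ) : ℂ)).re :=
    riemannZeta_re_pos_of_one_lt (by linarith)
  have h3 := h2.log hpos.ne'
  refine tendsto_nhds_unique (summable_uu hδ).hasSum.tendsto_sum_nat (h3.congr fun N => ?_)
  have e : ∏ p ∈ Nat.primesBelow N, (1 - (p : ℂ) ^ (-((1 + δ : ℝ) : ℂ)))⁻¹ =
      ((∏ p ∈ Nat.primesBelow N, (1 - (p : ℝ)⁻¹ * (p : ℝ) ^ (-δ))⁻¹ : ℝ) : ℂ) := by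
    rw [Complex.ofReal_prod]
    refine Finset.prod_congr rfl fun p hp => ?_
    have hp' : (0 : ℝ) < p := by exact_mod_cast (Nat.prime_of_mem_primesBelow hp).pos
    have : (p : ℝ)⁻¹ * (p : ℝ) ^ (-δ) = (p : ℝ) ^ (-(1 + δ)) := by
      rw [neg_add, Real.rpow_add hp', Real.rpow_neg_one]
    rw [this]
    push_cast
    rw [Complex.ofReal_cpow hp'.le]
    push_cast
    rfl
  simp only [Function.comp]
  rw [e, Complex.ofReal_re, Real.log_prod]
  · unfold uu
    rw [← Finset.sum_filter]
    refine Finset.sum_congr rfl fun p _ => ?_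
    rw [Real.log_inv]
  · intro p hp
    have hp' := Nat.prime_of_mem_primesBelow hp
    obtain ⟨q0, q1⟩ := rpow_bounds hδ.le hp'
    have y1 := inv_le_half hp'
    have y0 : 0 ≤ (p : ℝ)⁻¹ := by positivity
    have := mul_le_of_le_one_right y0 q1
    exact inv_ne_zero (by linarith)

lemma D_tendsto : Tendsto (fun δ : ℝ => ∑' n, tt n * (n : ℝ) ^ (-δ) + Real.log δ)
    (nhdsWithin 0 (Set.Ioi 0)) (nhds 0) := by
  have h1 := Asymptotics.isLittleO_one_iff ℝ |>.1 log_riemannZeta_add_log_sub_isLittleO_ofReal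
  have hsh : Tendsto (fun δ : ℝ => 1 + δ) (nhdsWithin 0 (Set.Ioi 0))
      (nhdsWithin 1 (Set.Ioi 1)) := by
    refine tendsto_nhdsWithin_iff.2 ⟨?_, ?_⟩
    · have : Tendsto (fun δ : ℝ => 1 + δ) (nhds 0) (nhds (1 + 0)) :=
        (continuous_const.add continuous_id).tendsto 0
      simpa using this.mono_left nhdsWithin_le_nhds
    · filter_upwards [self_mem_nhdsWithin] with δ hδ
      simpa using hδ
  have h2 := (h1.comp hsh).sub diff_tendsto
  rw [sub_zero] at h2
  refine h2.congr' ?_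
  filter_upwards [self_mem_nhdsWithin] with δ hδ
  have hδ' : 0 < δ := hδ
  simp only [Function.comp]
  rw [Summable.tsum_sub (summable_uu hδ') (summable_D hδ'), tsum_uu hδ', add_sub_cancel_left]
  ring

/-- dyadic block sums -/
noncomputable def bb (k : ℕ) : ℝ := ∑ n ∈ Finset.Ico (2 ^ k) (2 ^ (k + 1)), tt n

lemma sum_blocks (g : ℕ → ℝ) (hg : g 0 = 0) (K : ℕ) :
    ∑ k ∈ Finset.range K, ∑ n ∈ Finset.Ico (2 ^ k) (2 ^ (k + 1)), g n =
      ∑ n ∈ Finset.range (2 ^ K), g n := by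
  induction K with
  | zero => simp [hg]
  | succ K ih =>
    rw [Finset.sum_range_succ, ih]
    exact Finset.sum_range_add_sum_Ico _ (Nat.pow_le_pow_right (by norm_num) (by omega))

lemma tt_zero : tt 0 = 0 := by simp [tt]

lemma sum_inv (K : ℕ) : ∑ k ∈ Finset.range (K + 1), ((k : ℝ))⁻¹ = harmonic K := by
  rw [Finset.sum_range_succ']
  simp [harmonic]

lemma partial_tendsto {c : ℝ} (hc : Tendsto (fun N : ℕ => ∑ n ∈ Finset.range N, tt n -
    Real.log (Real.log N)) atTop (nhds c)) :
    Tendsto (fun K : ℕ => ∑ k ∈ Finset.range K, (bb k - (k : ℝ)⁻¹)) atTop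
      (nhds (c + Real.log (Real.log 2) - Real.eulerMascheroniConstant)) := by
  refine (tendsto_add_atTop_iff_nat 1).1 ?_
  have hp : Tendsto (fun K : ℕ => 2 ^ (K + 1)) atTop atTop :=
    (tendsto_pow_atTop_atTop_of_one_lt (r := (2 : ℕ)) (by norm_num)).comp (tendsto_add_atTop_nat 1)
  have h1 := ((hc.comp hp).add_const (Real.log (Real.log 2))).sub
    Real.tendsto_harmonic_sub_log_add_one
  refine h1.congr fun K => ?_
  rw [Finset.sum_sub_distrib, sum_inv]
  unfold bb
  rw [sum_blocks tt tt_zero]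
  simp only [Function.comp]
  have l2 : 0 < Real.log 2 := Real.log_pos (by norm_num)
  have : Real.log (Real.log ((2 ^ (K + 1) : ℕ) : ℝ)) = Real.log (K + 1) + Real.log (Real.log 2) := by
    push_cast
    rw [Real.log_pow, Real.log_mul (by positivity) l2.ne']
    push_cast
    rfl
  rw [this]
  ring

lemma block_bounds {δ : ℝ} (hδ : 0 < δ) (k : ℕ) :
    (2 : ℝ) ^ (-δ) * (bb k * ((2 : ℝ) ^ (-δ)) ^ k) ≤
      ∑ n ∈ Finset.Ico (2 ^ k) (2 ^ (k + 1)), tt n * (n : ℝ) ^ (-δ) ∧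
    ∑ n ∈ Finset.Ico (2 ^ k) (2 ^ (k + 1)), tt n * (n : ℝ) ^ (-δ) ≤
      bb k * ((2 : ℝ) ^ (-δ)) ^ k := by
  have key : ∀ j : ℕ, ((2 : ℝ) ^ (-δ)) ^ j = ((2 : ℝ) ^ j) ^ (-δ) := by
    intro j
    rw [← Real.rpow_natCast, ← Real.rpow_mul (by norm_num), mul_comm, Real.rpow_mul (by norm_num),
      Real.rpow_natCast]
  unfold bb
  constructor
  · rw [mul_left_comm, ← pow_succ', Finset.sum_mul, key]
    refine Finset.sum_le_sum fun n hn => mul_le_mul_of_nonneg_left ?_ (tt_nonneg n)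
    rw [Finset.mem_Ico] at hn
    have h1 : (0 : ℝ) < n := by
      exact_mod_cast lt_of_lt_of_le (by positivity) hn.1
    have h2 : (n : ℝ) ≤ 2 ^ (k + 1) := by exact_mod_cast hn.2.le
    exact Real.rpow_le_rpow_of_nonpos h1 h2 (by linarith)
  · rw [Finset.sum_mul, key]
    refine Finset.sum_le_sum fun n hn => mul_le_mul_of_nonneg_left ?_ (tt_nonneg n)
    rw [Finset.mem_Ico] at hn
    have h2 : (2 : ℝ) ^ k ≤ n := by exact_mod_cast hn.1
    exact Real.rpow_le_rpow_of_nonpos (by positivity) h2 (by linarith)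

lemma x_bounds {δ : ℝ} (hδ : 0 < δ) : 0 < (2 : ℝ) ^ (-δ) ∧ (2 : ℝ) ^ (-δ) < 1 :=
  ⟨by positivity, Real.rpow_lt_one_of_one_lt_of_neg (by norm_num) (by linarith)⟩

lemma bb_nonneg (k : ℕ) : 0 ≤ bb k := Finset.sum_nonneg fun n _ => tt_nonneg n

lemma bb_le (k : ℕ) : bb k ≤ 2 := by
  unfold bb
  have h : ∀ n ∈ Finset.Ico (2 ^ k) (2 ^ (k + 1)), tt n ≤ 2 * ((2 : ℝ) ^ k)⁻¹ := by
    intro n hn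
    rw [Finset.mem_Ico] at hn
    have h2 : (2 : ℝ) ^ k ≤ n := by exact_mod_cast hn.1
    refine (tt_le n).trans ?_
    have := inv_anti₀ (by positivity) h2
    linarith
  refine (Finset.sum_le_card_nsmul _ _ _ h).trans ?_
  rw [Nat.card_Ico, nsmul_eq_mul, show 2 ^ (k + 1) - 2 ^ k = 2 ^ k by rw [pow_succ]; omega]
  push_cast
  field_simp
  exact le_rfl

lemma summable_B {x : ℝ} (h0 : 0 < x) (h1 : x < 1) : Summable (fun k => bb k * x ^ k) := by
  refine Summable.of_nonneg_of_le (fun k => mul_nonneg (bb_nonneg k) (by positivity))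
    (fun k => mul_le_mul_of_nonneg_right (bb_le k) (by positivity))
    ((summable_geometric_of_lt_one h0.le h1).mul_left 2)

lemma B_bounds {δ : ℝ} (hδ : 0 < δ) :
    (2 : ℝ) ^ (-δ) * ∑' k, bb k * ((2 : ℝ) ^ (-δ)) ^ k ≤ ∑' n, tt n * (n : ℝ) ^ (-δ) ∧
    ∑' n, tt n * (n : ℝ) ^ (-δ) ≤ ∑' k, bb k * ((2 : ℝ) ^ (-δ)) ^ k := by
  obtain ⟨x0, x1⟩ := x_bounds hδ
  have hB := (summable_B x0 x1).hasSum.tendsto_sum_nat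
  have hp : Tendsto (fun K : ℕ => 2 ^ K) atTop atTop :=
    tendsto_pow_atTop_atTop_of_one_lt (r := (2 : ℕ)) (by norm_num)
  have hD := (summable_D hδ).hasSum.tendsto_sum_nat.comp hp
  constructor
  · refine le_of_tendsto_of_tendsto' (hB.const_mul _) hD fun K => ?_
    simp only [Function.comp]
    rw [← sum_blocks _ (by simp [tt_zero]), Finset.mul_sum]
    exact Finset.sum_le_sum fun k _ => (block_bounds hδ k).1
  · refine le_of_tendsto_of_tendsto' hD hB fun K => ?_
    simp only [Function.comp]
    rw [← sum_blocks _ (by simp [tt_zero])]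
    exact Finset.sum_le_sum fun k _ => (block_bounds hδ k).2

lemma tsum_f {x : ℝ} (h0 : 0 < x) (h1 : x < 1) :
    ∑' k : ℕ, (bb k - (k : ℝ)⁻¹) * x ^ k = ∑' k, bb k * x ^ k + Real.log (1 - x) := by
  have hl := Real.hasSum_pow_div_log_of_abs_lt_one (x := x) (by rw [abs_of_pos h0]; exact h1)
  have hl' : HasSum (fun k : ℕ => (k : ℝ)⁻¹ * x ^ k) (-Real.log (1 - x)) := by
    rw [← hasSum_nat_add_iff' 1]
    simpa [div_eq_inv_mul] using hl
  have := (summable_B h0 h1).hasSum.sub hl'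
  rw [sub_neg_eq_add] at this
  rw [← this.tsum_eq]
  refine tsum_congr fun k => by ring

lemma slope_tendsto (s : ℝ) : Tendsto (fun δ : ℝ => ((2 : ℝ) ^ (s * δ) - 1) / δ)
    (nhdsWithin 0 (Set.Ioi 0)) (nhds (s * Real.log 2)) := by
  have h : HasDerivAt (fun δ : ℝ => (2 : ℝ) ^ (s * δ)) (s * Real.log 2) 0 := by
    have h1 : HasDerivAt (fun δ : ℝ => s * δ) s 0 := by
      simpa using (hasDerivAt_id (0 : ℝ)).const_mul s
    have := h1.const_rpow (a := (2 : ℝ)) (by norm_num)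
    convert this using 1
    simp
    ring
  have := h.tendsto_slope_zero_right
  refine this.congr fun δ => ?_
  simp [div_eq_inv_mul]

lemma B_tendsto : Tendsto (fun δ : ℝ => ∑' k : ℕ, (bb k - (k : ℝ)⁻¹) * ((2 : ℝ) ^ (-δ)) ^ k)
    (nhdsWithin 0 (Set.Ioi 0)) (nhds (Real.log (Real.log 2))) := by
  have l2 : 0 < Real.log 2 := Real.log_pos (by norm_num)
  have hid : Tendsto (fun δ : ℝ => δ) (nhdsWithin 0 (Set.Ioi 0)) (nhds 0) := nhdsWithin_le_nhds
  -- main term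
  have s1 : Tendsto (fun δ : ℝ => Real.log (-(((2 : ℝ) ^ (-1 * δ) - 1) / δ)))
      (nhdsWithin 0 (Set.Ioi 0)) (nhds (Real.log (Real.log 2))) := by
    have := (slope_tendsto (-1)).neg.log (by simpa using l2.ne')
    simpa using this
  have m1 := D_tendsto.add s1
  rw [zero_add] at m1
  -- error term
  have s2 := slope_tendsto 1
  have s3 : Tendsto (fun δ : ℝ => δ * (∑' n, tt n * (n : ℝ) ^ (-δ)))
      (nhdsWithin 0 (Set.Ioi 0)) (nhds 0) := by
    have hml := (Real.continuous_mul_log.tendsto 0).mono_left (nhdsWithin_le_nhds (s := Set.Ioi 0))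
    have := (hid.mul D_tendsto).sub hml
    simp only [zero_mul, mul_zero, sub_zero] at this
    refine this.congr fun δ => by ring
  have m2 := s2.mul s3
  rw [mul_zero] at m2
  have m3 := m1.add m2
  rw [add_zero] at m3
  have hlog : ∀ δ : ℝ, 0 < δ → Real.log (1 - (2 : ℝ) ^ (-δ)) =
      Real.log δ + Real.log (-(((2 : ℝ) ^ (-1 * δ) - 1) / δ)) := by
    intro δ hδ
    obtain ⟨x0, x1⟩ := x_bounds hδ
    have e : -(((2 : ℝ) ^ (-1 * δ) - 1) / δ) = (1 - (2 : ℝ) ^ (-δ)) / δ := by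
      rw [neg_one_mul]; ring
    rw [e, Real.log_div (by linarith) hδ.ne']
    ring
  refine tendsto_of_tendsto_of_tendsto_of_le_of_le' m1 m3 ?_ ?_
  · filter_upwards [self_mem_nhdsWithin] with δ hδ
    have hδ' : 0 < δ := hδ
    obtain ⟨x0, x1⟩ := x_bounds hδ'
    rw [tsum_f x0 x1, hlog δ hδ']
    linarith [(B_bounds hδ').2]
  · filter_upwards [self_mem_nhdsWithin] with δ hδ
    have hδ' : 0 < δ := hδ
    obtain ⟨x0, x1⟩ := x_bounds hδ'
    rw [tsum_f x0 x1, hlog δ hδ']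
    have h1 := (B_bounds hδ').1
    have h2 : ∑' k, bb k * ((2 : ℝ) ^ (-δ)) ^ k ≤
        (2 : ℝ) ^ (1 * δ) * ∑' n, tt n * (n : ℝ) ^ (-δ) := by
      have h3 := mul_le_mul_of_nonneg_left h1 (show 0 ≤ (2 : ℝ) ^ (1 * δ) by positivity)
      rw [one_mul] at h3 ⊢
      rwa [← mul_assoc, ← Real.rpow_add (by norm_num), add_neg_cancel, Real.rpow_zero,
        one_mul] at h3
    have h4 : ((2 : ℝ) ^ (1 * δ) - 1) / δ * (δ * ∑' n, tt n * (n : ℝ) ^ (-δ)) =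
        (2 : ℝ) ^ (1 * δ) * (∑' n, tt n * (n : ℝ) ^ (-δ)) - ∑' n, tt n * (n : ℝ) ^ (-δ) := by
      field_simp
    rw [h4]
    linarith

theorem mertens_third_log : Tendsto (fun N : ℕ => ∑ n ∈ Finset.range N, tt n -
    Real.log (Real.log N)) atTop (nhds Real.eulerMascheroniConstant) := by
  obtain ⟨c, hc⟩ := mertens_exists
  have h1 := Real.tendsto_tsum_powerSeries_nhdsWithin_lt (partial_tendsto hc)
  have hx : Tendsto (fun δ : ℝ => (2 : ℝ) ^ (-δ)) (nhdsWithin 0 (Set.Ioi 0))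
      (nhdsWithin 1 (Set.Iio 1)) := by
    refine tendsto_nhdsWithin_iff.2 ⟨?_, ?_⟩
    · have : Continuous (fun δ : ℝ => (2 : ℝ) ^ (-δ)) :=
        Real.continuous_const_rpow (by norm_num) |>.comp continuous_neg
      have := (this.tendsto 0).mono_left (nhdsWithin_le_nhds (s := Set.Ioi 0))
      simpa using this
    · filter_upwards [self_mem_nhdsWithin] with δ hδ
      exact (x_bounds hδ).2
  have := tendsto_nhds_unique (h1.comp hx) B_tendsto
  have e : c = Real.eulerMascheroniConstant := by linarith
  exact e ▸ hc

lemma twin_partial : Tendsto (fun N : ℕ => ∏ p ∈ Finset.range N,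
    if p.Prime ∧ p ≠ 2 then (p : ℝ) * ((p : ℝ) - 2) / ((p : ℝ) - 1) ^ 2 else 1) atTop
    (nhds twinPrimeConstant) := by
  have hs : Summable (fun n : ℕ => ‖(if n.Prime ∧ n ≠ 2 then -(1 / ((n : ℝ) - 1) ^ 2) else 0)‖) := by
    refine Summable.of_nonneg_of_le (fun _ => norm_nonneg _) (fun n => ?_) summable_four
    split_ifs with h
    · have h2 : (2 : ℝ) ≤ n := by exact_mod_cast h.1.two_le
      rw [norm_neg, Real.norm_eq_abs, abs_of_nonneg (by positivity), inv_pow, ← div_eq_mul_inv,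
        div_le_div_iff₀ (by nlinarith) (by positivity)]
      nlinarith
    · simp
  have hm := multipliable_one_add_of_summable hs
  have h := hm.hasProd.tendsto_prod_nat
  have e : (fun n : ℕ => 1 + (if n.Prime ∧ n ≠ 2 then -(1 / ((n : ℝ) - 1) ^ 2) else 0)) =
    fun p : ℕ => if p.Prime ∧ p ≠ 2 then (p : ℝ) * ((p : ℝ) - 2) / ((p : ℝ) - 1) ^ 2 else 1 := by
    funext n
    split_ifs with h
    · have h2 : (2 : ℝ) ≤ n := by exact_mod_cast h.1.two_le
      have : (n : ℝ) - 1 ≠ 0 := by linarith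
      field_simp
      ring
    · simp
  rw [e] at h
  exact h

lemma prod_identity (N : ℕ) (hN : 3 ≤ N) :
    ∏ p ∈ (Finset.range N).filter (fun p => p.Prime ∧ 3 ≤ p), ((p : ℝ) - 2) / (p : ℝ) =
    4 * (∏ p ∈ Finset.range N,
      if p.Prime ∧ p ≠ 2 then (p : ℝ) * ((p : ℝ) - 2) / ((p : ℝ) - 1) ^ 2 else 1) *
      Real.exp (-2 * ∑ n ∈ Finset.range N, tt n) := by
  rw [Finset.prod_filter]
  induction N, hN using Nat.le_induction with
  | base =>
    have h2 : Nat.Prime 2 := Nat.prime_two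
    simp [Finset.prod_range_succ, Finset.sum_range_succ, tt, h2, Nat.not_prime_zero, Nat.not_prime_one]
    have : Real.log (1 - 2⁻¹) = -Real.log 2 := by
      rw [← Real.log_inv]; norm_num
    rw [this, show 2 * -Real.log 2 = -Real.log 2 + -Real.log 2 by ring, Real.exp_add,
      Real.exp_neg, Real.exp_log (by norm_num)]
    norm_num
  | succ N hN ih =>
    rw [Finset.prod_range_succ, ih, Finset.prod_range_succ, Finset.sum_range_succ, mul_add,
      Real.exp_add]
    by_cases h : N.Prime
    · have h3 : (3 : ℝ) ≤ N := by exact_mod_cast hN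
      have hy := inv_le_half h
      have e : Real.exp (-2 * tt N) = (1 - (N : ℝ)⁻¹) ^ 2 := by
        unfold tt
        rw [if_pos h, show -2 * -Real.log (1 - (N : ℝ)⁻¹) = Real.log (1 - (N : ℝ)⁻¹) +
          Real.log (1 - (N : ℝ)⁻¹) by ring, Real.exp_add, Real.exp_log (by linarith)]
        ring
      rw [e, if_pos ⟨h, hN⟩, if_pos ⟨h, by omega⟩]
      have n1 : (N : ℝ) - 1 ≠ 0 := by linarith
      have n0 : (N : ℝ) ≠ 0 := by linarith
      field_simp
    · simp [h, tt]

lemma log_ceil : Tendsto (fun x : ℝ => Real.log x / Real.log (⌈x⌉₊ : ℝ)) atTop (nhds 1) := by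
  have h1 : Tendsto (fun x : ℝ => (⌈x⌉₊ : ℝ) / x) atTop (nhds 1) := tendsto_nat_ceil_div_atTop
  have h2 : Tendsto (fun x : ℝ => Real.log ((⌈x⌉₊ : ℝ) / x)) atTop (nhds 0) := by
    simpa using h1.log one_ne_zero
  have h3 : Tendsto (fun x : ℝ => Real.log (⌈x⌉₊ : ℝ)) atTop atTop :=
    Real.tendsto_log_atTop.comp (tendsto_natCast_atTop_atTop.comp tendsto_nat_ceil_atTop)
  have h4 := (h2.div_atTop h3).const_sub 1
  rw [sub_zero] at h4
  refine h4.congr' ?_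
  filter_upwards [eventually_gt_atTop 0, h3.eventually_gt_atTop 0] with x hx hl
  have hc : (0 : ℝ) < ⌈x⌉₊ := by exact_mod_cast Nat.ceil_pos.2 hx
  rw [Real.log_div hc.ne' hx.ne']
  field_simp
  ring

end TPC

/-- As `x → ∞`, `(ln x)² · ∏_{p prime, 3 ≤ p < x} (p−2)/p` converges to
`4·e^{−2γ}·C₂`, where `γ` is the Euler–Mascheroni constant and `C₂` the twin prime
constant. -/
theorem stmt_10 :
    Tendsto (fun x : ℝ => (Real.log x) ^ 2 *
        ∏ p ∈ (Finset.range ⌈x⌉₊).filter (fun p => p.Prime ∧ 3 ≤ p),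
          ((p : ℝ) - 2) / (p : ℝ))
      atTop
      (nhds (4 * Real.exp (-2 * Real.eulerMascheroniConstant) * twinPrimeConstant)) := by
  have hcl : Tendsto (fun x : ℝ => ⌈x⌉₊) atTop atTop := tendsto_nat_ceil_atTop
  have h1 := TPC.mertens_third_log.comp hcl
  have h2 : Tendsto (fun x : ℝ => Real.exp (-2 * (∑ n ∈ Finset.range ⌈x⌉₊, TPC.tt n -
      Real.log (Real.log (⌈x⌉₊ : ℝ))))) atTop
      (nhds (Real.exp (-2 * Real.eulerMascheroniConstant))) :=
    (Real.continuous_exp.tendsto _).comp (h1.const_mul (-2))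
  have h3 := TPC.twin_partial.comp hcl
  have h4 := ((h2.const_mul 4).mul h3).mul (TPC.log_ceil.pow 2)
  rw [one_pow, mul_one] at h4
  refine h4.congr' ?_
  have hl : Tendsto (fun x : ℝ => Real.log (⌈x⌉₊ : ℝ)) atTop atTop :=
    Real.tendsto_log_atTop.comp (tendsto_natCast_atTop_atTop.comp hcl)
  filter_upwards [hcl.eventually_ge_atTop 3, hl.eventually_gt_atTop 0] with x hx hlx
  rw [TPC.prod_identity _ hx]
  simp only [Function.comp]
  have e : Real.exp (-2 * (∑ n ∈ Finset.range ⌈x⌉₊, TPC.tt n -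
      Real.log (Real.log (⌈x⌉₊ : ℝ)))) = Real.exp (-2 * ∑ n ∈ Finset.range ⌈x⌉₊, TPC.tt n) *
      Real.log (⌈x⌉₊ : ℝ) ^ 2 := by
    rw [mul_sub, show -2 * (∑ n ∈ Finset.range ⌈x⌉₊, TPC.tt n) -
      -2 * Real.log (Real.log (⌈x⌉₊ : ℝ)) = -2 * (∑ n ∈ Finset.range ⌈x⌉₊, TPC.tt n) +
      (Real.log (Real.log (⌈x⌉₊ : ℝ)) + Real.log (Real.log (⌈x⌉₊ : ℝ))) by ring, Real.exp_add,
      Real.exp_add, Real.exp_log hlx]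
    ring
  rw [e]
  field_simp
end

section
/- Define EGP_{B₂}(2n) = (n/2) · ∏_{p prime, 3 ≤ p < √(2n)} (p−2)/p for positive integers n. Then lim_{n→∞} EGP_{B₂}(2n) · (ln(2n))² / (2n) = 4·e^{−2γ}·C₂, where γ is the Euler–Mascheroni constant and C₂ = ∏_{p prime, p ≥ 3} p(p−2)/(p−1)² is the twin prime constant; numerically the limit is C ≈ 0.83235…. That is, the estimated number of Goldbach pairs for band B₂ is asymptotically C · 2n/(ln 2n)². -/
open Filter

/-- The paper's estimate of the number of Goldbach pairs of `2n` in band `B₂`: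
`EGP_{B₂}(2n) = (n/2) · ∏_{p prime, 3 ≤ p < √(2n)} (p−2)/p`. -/
noncomputable def EGPB2 (n : ℕ) : ℝ :=
  ((n : ℝ) / 2) *
    ∏ p ∈ (Finset.range ⌈Real.sqrt (2 * n)⌉₊).filter (fun p => p.Prime ∧ 3 ≤ p),
      ((p : ℝ) - 2) / (p : ℝ)

noncomputable def mw (n : ℕ) : ℝ := if n.Prime then Real.log n / n else 0

lemma log_fact_eq (N : ℕ) : Real.log (N.factorial) =
    ∑ p ∈ (Finset.range (N+1)).filter Nat.Prime, (N.factorial.factorization p : ℝ) * Real.log p := by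
  conv_lhs => rw [← Nat.prod_factorization_pow_eq_self (Nat.factorial_ne_zero N)]
  rw [Finsupp.prod, Nat.cast_prod, Real.log_prod]
  · rw [Nat.support_factorization]
    have hsub : N.factorial.primeFactors = (Finset.range (N+1)).filter Nat.Prime := by
      ext p
      simp only [Nat.mem_primeFactors, Finset.mem_filter, Finset.mem_range]
      constructor
      · rintro ⟨hp, hd, -⟩
        exact ⟨by have := (hp.dvd_factorial).1 hd; omega, hp⟩
      · rintro ⟨h, hp⟩
        exact ⟨hp, hp.dvd_factorial.2 (by omega), Nat.factorial_ne_zero N⟩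
    rw [hsub]
    refine Finset.sum_congr rfl fun p hp => ?_
    push_cast
    rw [Real.log_pow]
  · intro p hp
    rw [Nat.support_factorization] at hp
    have := (Nat.prime_of_mem_primeFactors hp).pos
    positivity

lemma fact_lower {p : ℕ} (hp : p.Prime) (N : ℕ) : N / p ≤ N.factorial.factorization p := by
  rcases lt_or_ge N p with h | h
  · rw [Nat.div_eq_of_lt h]; exact Nat.zero_le _
  rw [Nat.factorization_factorial hp (Nat.lt_succ_self (Nat.log p N))]
  have hl : 1 ≤ Nat.log p N := Nat.log_pos hp.one_lt h
  have := Finset.single_le_sum (f := fun i => N / p ^ i) (s := Finset.Ico 1 (Nat.log p N).succ)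
    (fun _ _ => Nat.zero_le _) (a := 1) (Finset.mem_Ico.2 ⟨le_rfl, by omega⟩)
  simpa using this

lemma mw_upper (N : ℕ) (hN : 1 ≤ N) :
    ∑ n ∈ Finset.range (N+1), mw n ≤ Real.log N + Real.log 4 := by
  have hN0 : (0:ℝ) < N := by exact_mod_cast hN
  have h1 := log_fact_eq N
  have h2 : Real.log (N.factorial) ≤ N * Real.log N := by
    rw [← Real.log_pow]
    apply Real.log_le_log (by exact_mod_cast Nat.factorial_pos N)
    exact_mod_cast Nat.factorial_le_pow N
  have h3 := Chebyshev.theta_le_log4_mul_x (x := (N:ℝ)) hN0.le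
  rw [Chebyshev.theta_eq_sum_Icc, Nat.floor_natCast, ← Nat.range_succ_eq_Icc_zero] at h3
  have h4 : N * ∑ n ∈ Finset.range (N+1), mw n ≤ Real.log (N.factorial) +
      ∑ p ∈ Finset.range (N+1) with Nat.Prime p, Real.log p := by
    rw [h1, ← Finset.sum_add_distrib, Finset.mul_sum, Finset.sum_filter]
    refine Finset.sum_le_sum fun p hp => ?_
    unfold mw
    split_ifs with hpp
    · have hl : 0 ≤ Real.log p := Real.log_natCast_nonneg p
      have hp0 : (0:ℝ) < p := by exact_mod_cast hpp.pos
      have : (N:ℝ) / p ≤ N.factorial.factorization p + 1 := by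
        have a : (N:ℝ) / p < ((N / p : ℕ) : ℝ) + 1 := by
          rw [← Nat.floor_div_eq_div (K := ℝ)]
          exact Nat.lt_floor_add_one _
        have b : ((N / p : ℕ) : ℝ) ≤ N.factorial.factorization p := by exact_mod_cast fact_lower hpp N
        linarith
      calc (N:ℝ) * (Real.log p / p) = N / p * Real.log p := by ring
        _ ≤ _ := mul_le_mul_of_nonneg_right this hl
        _ = _ := by ring
    · simp
  have : (N:ℝ) * ∑ n ∈ Finset.range (N+1), mw n ≤ N * (Real.log N + Real.log 4) := by
    nlinarith
  exact le_of_mul_le_mul_left this hN0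

lemma mw_lower : ∃ C, ∀ N : ℕ, 1 ≤ N → Real.log N - C ≤ ∑ n ∈ Finset.range (N+1), mw n := by
  have hs : Summable (fun n : ℕ => 4 * (1 / (n:ℝ) ^ (3/2:ℝ))) :=
    (Real.summable_one_div_nat_rpow.2 (by norm_num)).mul_left _
  refine ⟨1 + ∑' n : ℕ, 4 * (1 / (n:ℝ) ^ (3/2:ℝ)), fun N hN => ?_⟩
  have hN0 : (0:ℝ) < N := by exact_mod_cast hN
  have h1 := log_fact_eq N
  have h2 := Stirling.le_log_factorial_stirling (n := N) (by omega)
  have h2a : 0 ≤ Real.log N := Real.log_natCast_nonneg N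
  have h2b : 0 ≤ Real.log (2 * Real.pi) := Real.log_nonneg (by linarith [Real.pi_gt_three])
  have h3 := hs.sum_le_tsum (Finset.range (N+1)) (fun i _ => by positivity)
  have h4 : Real.log (N.factorial) ≤ ∑ n ∈ Finset.range (N+1), N * (mw n + 4 * (1 / (n:ℝ) ^ (3/2:ℝ))) := by
    rw [h1, Finset.sum_filter]
    refine Finset.sum_le_sum fun p hp => ?_
    unfold mw
    split_ifs with hpp
    · have hl : 0 ≤ Real.log p := Real.log_natCast_nonneg p
      have hp2 : (2:ℝ) ≤ p := by exact_mod_cast hpp.two_le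
      have hp0 : (0:ℝ) < p := by linarith
      have hf : (N.factorial.factorization p : ℝ) ≤ N / ((p:ℝ) - 1) := by
        have := Nat.factorization_factorial_le_div_pred hpp N
        have h' : (N.factorial.factorization p : ℝ) ≤ ((N / (p-1) : ℕ) : ℝ) := by exact_mod_cast this
        refine h'.trans (Nat.cast_div_le.trans ?_)
        rw [Nat.cast_sub hpp.one_le]; simp
      have hlog : Real.log p ≤ 2 * (p:ℝ) ^ (1/2:ℝ) := by
        have := Real.log_le_rpow_div hp0.le (show (0:ℝ) < 1/2 by norm_num)
        linarith
      have hpow : (p:ℝ) ^ (3/2:ℝ) * (p:ℝ) ^ (1/2:ℝ) = p ^ 2 := by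
        rw [← Real.rpow_add hp0]; norm_num
      have hq : 0 < (p:ℝ) ^ (3/2:ℝ) := by positivity
      have key : Real.log p / (p - 1) ≤ Real.log p / p + 4 * (1 / (p:ℝ) ^ (3/2:ℝ)) := by
        have e : Real.log p / (p - 1) = Real.log p / p + Real.log p / (p * (p-1)) := by
          have : (p:ℝ) - 1 ≠ 0 := by linarith
          field_simp; ring
        rw [e]
        gcongr
        rw [mul_one_div, div_le_div_iff₀ (by nlinarith) hq]
        calc Real.log p * (p:ℝ) ^ (3/2:ℝ) ≤ (2 * (p:ℝ) ^ (1/2:ℝ)) * (p:ℝ) ^ (3/2:ℝ) := by gcongr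
          _ = 2 * p ^ 2 := by rw [← hpow]; ring
          _ ≤ _ := by nlinarith
      calc _ ≤ N / ((p:ℝ) - 1) * Real.log p := mul_le_mul_of_nonneg_right hf hl
        _ = N * (Real.log p / (p - 1)) := by ring
        _ ≤ _ := mul_le_mul_of_nonneg_left key hN0.le
    · positivity
  rw [← Finset.mul_sum, Finset.sum_add_distrib] at h4
  have : (N:ℝ) * Real.log N - N ≤ N * (∑ n ∈ Finset.range (N+1), mw n + ∑ n ∈ Finset.range (N+1), 4 * (1 / (n:ℝ) ^ (3/2:ℝ))) := by
    linarith
  have h5 : Real.log N - 1 ≤ (∑ n ∈ Finset.range (N+1), mw n + ∑ n ∈ Finset.range (N+1), 4 * (1 / (n:ℝ) ^ (3/2:ℝ))) := by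
    apply le_of_mul_le_mul_left _ hN0
    linarith
  linarith

noncomputable def mg (n : ℕ) : ℝ := if n.Prime then -Real.log (1 - 1 / n) else 0

lemma log_approx {y : ℝ} (h0 : 0 ≤ y) (h1 : y ≤ 1/2) : |-Real.log (1 - y) - y| ≤ 2 * y ^ 2 := by
  have := Real.abs_log_sub_add_sum_range_le (x := y) (by rw [abs_of_nonneg h0]; linarith) 1
  simp only [Finset.sum_range_one, abs_of_nonneg h0] at this
  rw [← abs_neg]
  calc _ = |y ^ (0 + 1) / ((0:ℕ) + 1 : ℝ) + Real.log (1 - y)| := by congr 1; push_cast; ring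
    _ ≤ _ := this
    _ ≤ _ := by
      rw [div_le_iff₀ (by linarith)]
      have : 0 ≤ y ^ 2 * (1 - 2 * y) := mul_nonneg (sq_nonneg y) (by linarith)
      norm_num
      linarith

lemma mg_summable : Summable (fun n : ℕ => mg n - if n.Prime then 1 / (n:ℝ) else 0) := by
  refine Summable.of_norm_bounded (g := fun n : ℕ => 2 * (1 / (n:ℝ) ^ 2))
    ((Real.summable_one_div_nat_pow.2 (by norm_num)).mul_left _) fun n => ?_
  unfold mg
  split_ifs with h
  · have h2 : (2:ℝ) ≤ n := by exact_mod_cast h.two_le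
    have := log_approx (y := 1 / (n:ℝ)) (by positivity) (by
      rw [div_le_div_iff₀ (by linarith) (by norm_num)]; linarith)
    rw [Real.norm_eq_abs]
    refine this.trans (le_of_eq ?_)
    rw [div_pow, one_pow]
  · simp

lemma inv_log_antitone : Antitone (fun i : ℕ => 1 / Real.log (i + 2)) := by
  intro i j hij
  have : (i:ℝ) ≤ j := by exact_mod_cast hij
  have hi : (0:ℝ) ≤ i := by positivity
  apply one_div_le_one_div_of_le
  · exact Real.log_pos (by linarith)
  · exact Real.log_le_log (by linarith) (by linarith)

lemma inv_log_tendsto : Tendsto (fun i : ℕ => 1 / Real.log (i + 2)) atTop (nhds 0) := by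
  simp_rw [one_div]
  apply tendsto_inv_atTop_zero.comp
  apply Real.tendsto_log_atTop.comp
  exact tendsto_atTop_add_const_right _ _ tendsto_natCast_atTop_atTop

lemma mertens2a : ∃ c, Tendsto (fun N : ℕ => ∑ i ∈ Finset.range N,
    (1 / Real.log (i + 2)) • (mw (i + 2) - (Real.log (i + 3) - Real.log (i + 2)))) atTop (nhds c) := by
  obtain ⟨C, hC⟩ := mw_lower
  apply cauchySeq_tendsto_of_complete
  refine Antitone.cauchySeq_series_mul_of_tendsto_zero_of_bounded (b := |C| + Real.log 4 + 2) inv_log_antitone inv_log_tendsto ?_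
  intro n
  have e1 : ∑ i ∈ Finset.range n, (Real.log ((i:ℝ) + 3) - Real.log (i + 2)) = Real.log (n + 2) - Real.log 2 := by
    have := Finset.sum_range_sub (fun i : ℕ => Real.log ((i:ℝ) + 2)) n
    simp only [Nat.cast_zero, zero_add] at this
    rw [← this]
    refine Finset.sum_congr rfl fun i _ => ?_
    push_cast; ring_nf
  have e2 : ∑ i ∈ Finset.range n, mw (i+2) = ∑ i ∈ Finset.range (n+1+1), mw i := by
    rw [Finset.sum_range_succ', Finset.sum_range_succ']
    have h0 : mw 0 = 0 := by simp [mw]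
    have h1 : mw (0 + 1) = 0 := by simp [mw]
    rw [h0, h1, add_zero, add_zero]
  have h1 := mw_upper (n+1) (by omega)
  have h2 := hC (n+1) (by omega)
  rw [Finset.sum_sub_distrib, e1, e2, Real.norm_eq_abs, abs_le]
  have l2 : Real.log 2 < 1 := by linarith [Real.log_two_lt_d9]
  have l2' : 0 < Real.log 2 := Real.log_pos (by norm_num)
  have l4 : 0 < Real.log 4 := Real.log_pos (by norm_num)
  have hn : (0:ℝ) ≤ n := by positivity
  have d1 : Real.log ((n+1 : ℕ):ℝ) ≤ Real.log (n+2) :=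
    Real.log_le_log (by positivity) (by push_cast; linarith)
  have d2 : Real.log (n+2) ≤ Real.log ((n+1 : ℕ):ℝ) + Real.log 2 := by
    rw [← Real.log_mul (by positivity) (by norm_num)]
    exact Real.log_le_log (by positivity) (by push_cast; linarith)
  have := le_abs_self C
  have := abs_nonneg C
  constructor <;> linarith

lemma loglog_summable : Summable (fun i : ℕ => (1 / Real.log (i + 2)) * (Real.log (i + 3) - Real.log (i + 2))
    - (Real.log (Real.log (i+3)) - Real.log (Real.log (i+2)))) := by
  have main : ∀ i : ℕ, 0 ≤ (1 / Real.log (i + 2)) * (Real.log (i + 3) - Real.log (i + 2))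
    - (Real.log (Real.log (i+3)) - Real.log (Real.log (i+2))) ∧
     (1 / Real.log (i + 2)) * (Real.log (i + 3) - Real.log (i + 2))
    - (Real.log (Real.log (i+3)) - Real.log (Real.log (i+2))) ≤
      1 / Real.log ((i:ℕ) + 2) - 1 / Real.log ((i+1:ℕ) + 2) := by
    intro i
    have hi : (0:ℝ) ≤ i := by positivity
    have e3 : (((i+1:ℕ):ℝ) + 2) = i + 3 := by push_cast; ring
    rw [e3]
    have ha : 0 < Real.log ((i:ℝ)+2) := Real.log_pos (by linarith)
    have hab : Real.log ((i:ℝ)+2) ≤ Real.log ((i:ℝ)+3) := Real.log_le_log (by linarith) (by linarith)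
    have hab1 : Real.log ((i:ℝ)+3) ≤ Real.log ((i:ℝ)+2) + 1 := by
      have h2 : Real.log 2 < 1 := by linarith [Real.log_two_lt_d9]
      have : Real.log ((i:ℝ)+3) ≤ Real.log ((i:ℝ)+2) + Real.log 2 := by
        rw [← Real.log_mul (by positivity) (by norm_num)]
        exact Real.log_le_log (by linarith) (by linarith)
      linarith
    generalize Real.log ((i:ℝ)+2) = a at *
    generalize Real.log ((i:ℝ)+3) = b at *
    have hb : 0 < b := by linarith
    have u1 : Real.log b - Real.log a ≤ b / a - 1 := by
      rw [← Real.log_div hb.ne' ha.ne']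
      exact Real.log_le_sub_one_of_pos (by positivity)
    have u2 : Real.log a - Real.log b ≤ a / b - 1 := by
      rw [← Real.log_div ha.ne' hb.ne']
      exact Real.log_le_sub_one_of_pos (by positivity)
    have x1 : 1 / a * (b - a) = b / a - 1 := by field_simp
    have x2 : 1 - a / b = 1 / b * (b - a) := by field_simp
    have x3 : 1 / b ≤ 1 / a := one_div_le_one_div_of_le ha hab
    constructor
    · linarith
    · have : (1/a - 1/b) * (b - a) ≤ (1/a - 1/b) * 1 :=
        mul_le_mul_of_nonneg_left (by linarith) (by linarith)
      nlinarith
  refine Summable.of_nonneg_of_le (fun i => (main i).1) (fun i => (main i).2) ?_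
  apply summable_of_sum_range_le (c := 1 / Real.log 2)
  · intro i; exact (main i).1.trans (main i).2
  · intro n
    rw [Finset.sum_range_sub' (fun i : ℕ => 1 / Real.log ((i:ℝ) + 2)) n]
    have : 0 ≤ 1 / Real.log ((n:ℝ)+2) := by
      have hn : (0:ℝ) ≤ n := by positivity
      have := Real.log_nonneg (x := (n:ℝ)+2) (by linarith)
      positivity
    simp only [Nat.cast_zero, zero_add]
    linarith

lemma mertens2 : ∃ c, Tendsto (fun N : ℕ => ∑ n ∈ Finset.range N, mg n - Real.log (Real.log N)) atTop (nhds c) := by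
  obtain ⟨c1, h1⟩ := mertens2a
  have h2 := loglog_summable.hasSum.tendsto_sum_nat
  have h3 := mg_summable.hasSum.tendsto_sum_nat
  have h3' := h3.comp (tendsto_add_atTop_nat 2)
  refine ⟨_, (tendsto_add_atTop_iff_nat 2).1 ((((h1.add h2).add h3').sub_const (Real.log (Real.log 2))).congr fun N => ?_)⟩
  simp only [Function.comp]
  rw [← Finset.sum_add_distrib, Finset.sum_sub_distrib]
  have e1 : ∑ i ∈ Finset.range (N+2), (if i.Prime then 1 / (i:ℝ) else 0) =
      ∑ i ∈ Finset.range N, (1 / Real.log (i + 2)) * mw (i+2) := by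
    rw [Finset.sum_range_succ', Finset.sum_range_succ']
    simp only [zero_add, Nat.not_prime_zero, Nat.not_prime_one, if_false, add_zero]
    refine Finset.sum_congr rfl fun i _ => ?_
    unfold mw
    have : Real.log ((i:ℝ)+2) ≠ 0 := (Real.log_pos (by linarith [(Nat.cast_nonneg i : (0:ℝ) ≤ i)])).ne'
    split_ifs with h
    · push_cast
      field_simp
      ring
    · simp
  have e2 : ∑ i ∈ Finset.range N, (Real.log (Real.log ((i:ℝ) + 3)) - Real.log (Real.log (i + 2))) = Real.log (Real.log (N + 2)) - Real.log (Real.log 2) := by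
    have := Finset.sum_range_sub (fun i : ℕ => Real.log (Real.log ((i:ℝ) + 2))) N
    simp only [Nat.cast_zero, zero_add] at this
    rw [← this]
    refine Finset.sum_congr rfl fun i _ => ?_
    push_cast; ring_nf
  rw [e1]
  have e3 : ∑ i ∈ Finset.range N, ((1 / Real.log ((i:ℝ) + 2)) • (mw (i + 2) - (Real.log (i + 3) - Real.log (i + 2))) + 
    ((1 / Real.log (i + 2)) * (Real.log (i + 3) - Real.log (i + 2))
    - (Real.log (Real.log (i+3)) - Real.log (Real.log (i+2))))) = ∑ i ∈ Finset.range N, (1 / Real.log (i + 2)) * mw (i+2) - ∑ i ∈ Finset.range N, (Real.log (Real.log ((i:ℝ) + 3)) - Real.log (Real.log (i + 2))) := by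
    rw [← Finset.sum_sub_distrib]
    refine Finset.sum_congr rfl fun i _ => ?_
    rw [smul_eq_mul]; ring
  rw [e3, e2]
  push_cast
  ring

lemma zeta_log {s : ℝ} (hs : 0 < s) :
    HasSum (fun n : ℕ => if n.Prime then -Real.log (1 - (n:ℝ) ^ (-(1+s))) else 0)
      (Real.log (∑' n : ℕ, 1 / (n:ℝ) ^ (1+s))) := by
  let f : ℕ →*₀ ℝ :=
    { toFun := fun n => (n:ℝ) ^ (-(1+s))
      map_zero' := by
        rw [Nat.cast_zero, Real.zero_rpow (by linarith)]
      map_one' := by simp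
      map_mul' := fun a b => by
        push_cast
        rw [Real.mul_rpow (by positivity) (by positivity)] }
  have hf : ∀ n : ℕ, f n = (n:ℝ) ^ (-(1+s)) := fun n => rfl
  have hf' : ∀ n : ℕ, f n = 1 / (n:ℝ) ^ (1+s) := fun n => by
    rw [hf, Real.rpow_neg (by positivity), one_div]
  have hsum : Summable (fun n : ℕ => f n) := by
    simp_rw [hf']
    exact Real.summable_one_div_nat_rpow.2 (by linarith)
  have hprod := EulerProduct.eulerProduct_completely_multiplicative_hasProd (f := f) hsum.norm
  have hpos : 0 < ∑' n : ℕ, f n :=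
    hsum.tsum_pos (fun n => by rw [hf]; positivity) 1 (by rw [hf]; simp)
  have hlog := (Real.continuousAt_log hpos.ne').tendsto.comp hprod
  have hS : HasSum (fun p : Nat.Primes => -Real.log (1 - f p)) (Real.log (∑' n : ℕ, f n)) := by
    refine hlog.congr fun t => ?_
    simp only [Function.comp]
    rw [Real.log_prod]
    · refine Finset.sum_congr rfl fun p _ => ?_
      rw [Real.log_inv]
    · intro p _
      apply inv_ne_zero
      have hp : (1:ℝ) < (p:ℕ) := by exact_mod_cast p.2.one_lt
      have : f p < 1 := by
        rw [hf]; exact Real.rpow_lt_one_of_one_lt_of_neg hp (by linarith)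
      linarith
  have hS2 := (hasSum_subtype_iff_indicator (f := fun n : ℕ => -Real.log (1 - f n)) (s := {p | p.Prime})).1 hS
  simp_rw [hf'] at hS2 ⊢
  convert hS2 using 1
  ext n
  simp only [Set.indicator, Set.mem_ofPred_eq]
  rw [Real.rpow_neg (by positivity), one_div]

lemma mg_bound (n : ℕ) : 0 ≤ mg n ∧ mg n ≤ 2 / n := by
  unfold mg
  split_ifs with h
  · have h2 : (2:ℝ) ≤ n := by exact_mod_cast h.two_le
    have hy : 1 / (n:ℝ) ≤ 1/2 := by
      rw [div_le_div_iff₀ (by linarith) (by norm_num)]; linarith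
    have hy0 : 0 ≤ 1 / (n:ℝ) := by positivity
    have := abs_le.1 (log_approx hy0 hy)
    constructor
    · have := Real.log_nonpos (x := 1 - 1 / (n:ℝ)) (by linarith) (by linarith)
      linarith
    · have e : (2:ℝ) / n = 2 * (1 / n) := by ring
      rw [e]
      nlinarith
  · exact ⟨le_rfl, by positivity⟩

lemma mg_dirichlet_summable {s : ℝ} (hs : 0 < s) : Summable (fun n : ℕ => mg n * (n:ℝ) ^ (-s)) := by
  refine Summable.of_nonneg_of_le (f := fun n : ℕ => 2 * (1 / (n:ℝ) ^ (1+s))) (fun n => mul_nonneg (mg_bound n).1 (by positivity)) (fun n => ?_)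
    ((Real.summable_one_div_nat_rpow.2 (by linarith)).mul_left 2)
  rcases Nat.eq_zero_or_pos n with rfl | hn
  · simp [mg]; positivity
  have hn0 : (0:ℝ) < n := by exact_mod_cast hn
  calc mg n * (n:ℝ) ^ (-s) ≤ 2 / n * (n:ℝ) ^ (-s) := mul_le_mul_of_nonneg_right (mg_bound n).2 (by positivity)
    _ = _ := by
      rw [Real.rpow_add hn0, Real.rpow_neg hn0.le, Real.rpow_one]; field_simp

lemma mg_diff : Tendsto (fun s : ℝ => ∑' n : ℕ, (mg n * (n:ℝ) ^ (-s) -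
    (if n.Prime then -Real.log (1 - (n:ℝ) ^ (-(1+s))) else 0))) (nhdsWithin 0 (Set.Ioi 0)) (nhds 0) := by
  have key := tendsto_tsum_of_dominated_convergence (𝓕 := nhdsWithin (0:ℝ) (Set.Ioi 0))
    (f := fun (s : ℝ) (n : ℕ) => (mg n * (n:ℝ) ^ (-s) -
    (if n.Prime then -Real.log (1 - (n:ℝ) ^ (-(1+s))) else 0))) (g := fun _ => (0:ℝ))
    (bound := fun n : ℕ => 4 * (1 / (n:ℝ) ^ 2))
    ((Real.summable_one_div_nat_pow.2 (by norm_num)).mul_left _) ?_ ?_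
  · simpa using key
  · intro n
    apply tendsto_nhdsWithin_of_tendsto_nhds
    unfold mg
    split_ifs with h
    · have h2 : (2:ℝ) ≤ n := by exact_mod_cast h.two_le
      have hn0 : (n:ℝ) ≠ 0 := by linarith
      have hc : ContinuousAt (fun s : ℝ => -Real.log (1 - 1 / (n:ℝ)) * (n:ℝ) ^ (-s) - -Real.log (1 - (n:ℝ) ^ (-(1+s)))) 0 := by
        have c1 : ContinuousAt (fun s : ℝ => (n:ℝ) ^ (-s)) 0 :=
          ContinuousAt.rpow continuousAt_const continuousAt_id.neg (Or.inl hn0)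
        have c2 : ContinuousAt (fun s : ℝ => (n:ℝ) ^ (-(1+s))) 0 :=
          ContinuousAt.rpow continuousAt_const (continuousAt_const.add continuousAt_id).neg (Or.inl hn0)
        refine (continuousAt_const.mul c1).sub (ContinuousAt.log (continuousAt_const.sub c2) ?_).neg
        have : (n:ℝ) ^ (-(1+(0:ℝ))) < 1 := Real.rpow_lt_one_of_one_lt_of_neg (by linarith) (by norm_num)
        exact (sub_pos.2 this).ne'
      have := hc.tendsto
      convert this using 2
      simp [Real.rpow_neg_one]
    · simp
  · filter_upwards [self_mem_nhdsWithin] with s hs n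
    have hs : 0 < s := hs
    unfold mg
    split_ifs with h
    · have h2 : (2:ℝ) ≤ n := by exact_mod_cast h.two_le
      have hn0 : (0:ℝ) < n := by linarith
      have e : (n:ℝ) ^ (-(1+s)) = 1 / n * (n:ℝ) ^ (-s) := by
        rw [neg_add, Real.rpow_add hn0, Real.rpow_neg_one, one_div]
      have hr1 : (n:ℝ) ^ (-s) ≤ 1 := Real.rpow_le_one_of_one_le_of_nonpos (by linarith) (by linarith)
      have hr0 : 0 ≤ (n:ℝ) ^ (-s) := by positivity
      rw [e]
      have hy : 1 / (n:ℝ) ≤ 1/2 := by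
        rw [div_le_div_iff₀ (by linarith) (by norm_num)]; linarith
      have hy0 : 0 ≤ 1 / (n:ℝ) := by positivity
      have e2 : 1 / (n:ℝ)^2 = (1/(n:ℝ))^2 := by rw [div_pow, one_pow]
      rw [e2, Real.norm_eq_abs]
      generalize (n:ℝ) ^ (-s) = r at *
      generalize 1 / (n:ℝ) = y at *
      have hyr : y * r ≤ y := mul_le_of_le_one_right hy0 hr1
      have a1 := log_approx hy0 hy
      have a2 := log_approx (y := y * r) (mul_nonneg hy0 hr0) (by linarith)
      have a3 : |(-Real.log (1 - y) - y) * r| ≤ 2 * y ^ 2 := by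
        rw [abs_mul, abs_of_nonneg hr0]
        exact (mul_le_of_le_one_right (abs_nonneg _) hr1).trans a1
      have a4 : (y * r) ^ 2 ≤ y ^ 2 := pow_le_pow_left₀ (mul_nonneg hy0 hr0) hyr 2
      rw [abs_le] at a2 a3 ⊢
      constructor <;> nlinarith
    · simp

lemma mg_dirichlet : Tendsto (fun s : ℝ => ∑' n : ℕ, mg n * (n:ℝ) ^ (-s) + Real.log s)
    (nhdsWithin 0 (Set.Ioi 0)) (nhds 0) := by
  have hz : Tendsto (fun s : ℝ => Real.log (s * ∑' n : ℕ, 1 / (n:ℝ) ^ (1+s))) (nhdsWithin 0 (Set.Ioi 0)) (nhds 0) := by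
    have h1 : Tendsto (fun s : ℝ => 1 + s) (nhdsWithin 0 (Set.Ioi 0)) (nhdsWithin 1 (Set.Ioi 1)) := by
      apply tendsto_nhdsWithin_of_tendsto_nhds_of_eventually_within
      · apply tendsto_nhdsWithin_of_tendsto_nhds
        have : ContinuousAt (fun s : ℝ => 1 + s) 0 := by fun_prop
        simpa using this.tendsto
      · filter_upwards [self_mem_nhdsWithin] with s hs
        have hs : 0 < s := hs
        simpa using hs
    have h2 := tendsto_sub_mul_tsum_nat_rpow.comp h1
    have h3 := (Real.continuousAt_log (one_ne_zero)).tendsto.comp h2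
    rw [Real.log_one] at h3
    refine h3.congr fun s => ?_
    simp
  have := mg_diff.add hz
  rw [add_zero] at this
  refine this.congr' ?_
  filter_upwards [self_mem_nhdsWithin] with s hs
  have hs : 0 < s := hs
  have hl := zeta_log hs
  have hsum : Summable (fun n : ℕ => 1 / (n:ℝ) ^ (1+s)) := Real.summable_one_div_nat_rpow.2 (by linarith)
  have hpos : 0 < ∑' n : ℕ, 1 / (n:ℝ) ^ (1+s) :=
    hsum.tsum_pos (fun n => by positivity) 1 (by simp)
  rw [(mg_dirichlet_summable hs).tsum_sub hl.summable, hl.tsum_eq, Real.log_mul hs.ne' hpos.ne']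
  ring

lemma exp_neg_lt_one {s : ℝ} (hs : 0 < s) : Real.exp (-s) < 1 := by
  have := Real.exp_lt_exp.2 (show -s < 0 by linarith)
  rwa [Real.exp_zero] at this

open MeasureTheory in
lemma ind_integrable (a : ℝ) : Integrable (Set.indicator (Set.Ici a) (fun u : ℝ => Real.exp (-u)))
    (volume.restrict (Set.Ioi 0)) :=
  Integrable.indicator (integrableOn_exp_neg_Ioi 0) measurableSet_Ici

open MeasureTheory in
lemma ind_integral {a : ℝ} (ha : 0 ≤ a) :
    ∫ u in Set.Ioi 0, Set.indicator (Set.Ici a) (fun u : ℝ => Real.exp (-u)) u = Real.exp (-a) := by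
  rw [integral_indicator measurableSet_Ici, Measure.restrict_restrict measurableSet_Ici,
    ← integral_exp_neg_Ioi a]
  apply setIntegral_congr_set
  have h1 : (Set.Ici a ∩ Set.Ioi 0 : Set ℝ) =ᵐ[volume] (Set.Ioi a ∩ Set.Ioi 0 : Set ℝ) :=
    Ioi_ae_eq_Ici.symm.inter (ae_eq_refl _)
  refine h1.trans (Eq.eventuallyEq ?_)
  apply Set.inter_eq_left.2
  exact Set.Ioi_subset_Ioi ha

noncomputable def mD (t : ℝ) : ℝ :=
  ∑ n ∈ Finset.range (⌊Real.exp t⌋₊ + 1), mg n - ∑ n ∈ Finset.range (⌊t⌋₊ + 1), 1 / (n:ℝ)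

lemma mg_exp (s : ℝ) (n : ℕ) : mg n * Real.exp (-(s * Real.log n)) = mg n * (n:ℝ) ^ (-s) := by
  rcases Nat.eq_zero_or_pos n with rfl | hn
  · simp [mg]
  · rw [Real.rpow_def_of_pos (by exact_mod_cast hn)]
    congr 2; ring

lemma harm_hasSum {s : ℝ} (hs : 0 < s) :
    HasSum (fun n : ℕ => 1 / (n:ℝ) * Real.exp (-(s * n))) (-Real.log (1 - Real.exp (-s))) := by
  have h := Real.hasSum_pow_div_log_of_abs_lt_one (x := Real.exp (-s)) (by
    rw [abs_of_pos (Real.exp_pos _)]; exact exp_neg_lt_one hs)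
  have h2 := (hasSum_nat_add_iff (f := fun n : ℕ => 1 / (n:ℝ) * Real.exp (-(s * n))) (g := -Real.log (1 - Real.exp (-s))) 1).1 (by
    have e : (fun n : ℕ => 1 / ((n + 1 : ℕ):ℝ) * Real.exp (-(s * ((n + 1 : ℕ):ℝ)))) =
        fun n : ℕ => Real.exp (-s) ^ (n + 1) / ((n:ℝ) + 1) := by
      ext n
      rw [← Real.exp_nat_mul]
      push_cast
      rw [one_div, div_eq_inv_mul]
      congr 2; ring
    rw [e]
    simpa using h)
  simpa using h2

open MeasureTheory in
lemma mD_integral {s : ℝ} (hs : 0 < s) :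
    ∑' n : ℕ, mg n * (n:ℝ) ^ (-s) + Real.log (1 - Real.exp (-s)) =
      ∫ u in Set.Ioi 0, mD (u / s) * Real.exp (-u) := by
  let I : ℝ → ℝ → ℝ := fun a => Set.indicator (Set.Ici a) (fun u : ℝ => Real.exp (-u))
  have hI0 : ∀ a u, 0 ≤ I a u := fun a u => Set.indicator_nonneg (fun _ _ => (Real.exp_pos _).le) u
  have hIi : ∀ a, Integrable (I a) (volume.restrict (Set.Ioi 0)) := ind_integrable
  have hIe : ∀ a, 0 ≤ a → ∫ u in Set.Ioi 0, I a u = Real.exp (-a) := fun a ha => ind_integral ha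
  let F : ℕ → ℝ → ℝ := fun n u => mg n * I (s * Real.log n) u - 1 / (n:ℝ) * I (s * n) u
  have hlog : ∀ n : ℕ, 0 ≤ s * Real.log n := fun n => mul_nonneg hs.le (Real.log_natCast_nonneg n)
  have hsn : ∀ n : ℕ, 0 ≤ s * (n:ℝ) := fun n => by positivity
  have hF : ∀ n, Integrable (F n) (volume.restrict (Set.Ioi 0)) := fun n =>
    ((hIi _).const_mul _).sub ((hIi _).const_mul _)
  have hm := mg_dirichlet_summable hs
  have hh := harm_hasSum hs
  have hFs : Summable (fun n => ∫ u in Set.Ioi 0, ‖F n u‖) := by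
    refine Summable.of_nonneg_of_le (fun n => integral_nonneg fun u => norm_nonneg _) (fun n => ?_) (hm.add hh.summable)
    calc ∫ u in Set.Ioi 0, ‖F n u‖ ≤ ∫ u in Set.Ioi 0, (mg n * I (s * Real.log n) u + 1 / (n:ℝ) * I (s * n) u) := by
          apply integral_mono (hF n).norm (((hIi _).const_mul _).add ((hIi _).const_mul _))
          intro u
          simp only [F, Real.norm_eq_abs, Pi.add_apply]
          have a := mul_nonneg (mg_bound n).1 (hI0 (s * Real.log n) u)
          have b := mul_nonneg (show (0:ℝ) ≤ 1 / n by positivity) (hI0 (s * n) u)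
          rw [abs_le]; constructor <;> linarith
      _ = _ := by
          rw [integral_add ((hIi _).const_mul _) ((hIi _).const_mul _), integral_const_mul, integral_const_mul,
            hIe _ (hlog n), hIe _ (hsn n), mg_exp]
  have H := hasSum_integral_of_summable_integral_norm hF hFs
  have e1 : ∀ n, ∫ u in Set.Ioi 0, F n u = mg n * (n:ℝ) ^ (-s) - 1 / (n:ℝ) * Real.exp (-(s * n)) := by
    intro n
    rw [integral_sub ((hIi _).const_mul _) ((hIi _).const_mul _), integral_const_mul, integral_const_mul,
            hIe _ (hlog n), hIe _ (hsn n), mg_exp]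
  simp_rw [e1] at H
  have H2 := hm.hasSum.sub hh
  have H3 := H2.unique H
  rw [sub_neg_eq_add] at H3
  rw [H3]
  apply setIntegral_congr_fun measurableSet_Ioi
  intro u hu
  have hu : 0 < u := hu
  have s1 : HasSum (fun n : ℕ => mg n * I (s * Real.log n) u) (∑ n ∈ Finset.range (⌊Real.exp (u/s)⌋₊ + 1), mg n * I (s * Real.log n) u) := by
    apply hasSum_sum_of_ne_finset_zero
    intro n hn
    simp only [Finset.mem_range, not_lt] at hn
    have : I (s * Real.log n) u = 0 := by
      apply Set.indicator_of_notMem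
      simp only [Set.mem_Ici, not_le]
      have h1 : Real.exp (u/s) < n := (Nat.floor_lt (Real.exp_pos _).le).1 (by omega)
      have h2 := (Real.lt_log_iff_exp_lt ((Real.exp_pos _).trans h1)).2 h1
      rw [div_lt_iff₀ hs] at h2
      linarith
    rw [this, mul_zero]
  have s2 : HasSum (fun n : ℕ => 1 / (n:ℝ) * I (s * n) u) (∑ n ∈ Finset.range (⌊u/s⌋₊ + 1), 1 / (n:ℝ) * I (s * n) u) := by
    apply hasSum_sum_of_ne_finset_zero
    intro n hn
    simp only [Finset.mem_range, not_lt] at hn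
    have : I (s * n) u = 0 := by
      apply Set.indicator_of_notMem
      simp only [Set.mem_Ici, not_le]
      have h2 : u/s < n := (Nat.floor_lt (by positivity)).1 (by omega)
      rw [div_lt_iff₀ hs] at h2
      linarith
    rw [this, mul_zero]
  show ∑' n, F n u = mD (u / s) * Real.exp (-u)
  rw [(s1.sub s2).tsum_eq, mD, sub_mul, Finset.sum_mul, Finset.sum_mul]
  congr 1
  · refine Finset.sum_congr rfl fun n hn => ?_
    rcases Nat.eq_zero_or_pos n with rfl | hn0
    · simp [mg]
    congr 1
    apply Set.indicator_of_mem
    simp only [Finset.mem_range, Set.mem_Ici] at hn ⊢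
    have h1 : (n:ℝ) ≤ Real.exp (u/s) := (Nat.le_floor_iff (Real.exp_pos _).le).1 (by omega)
    have h2 := (Real.log_le_iff_le_exp (by exact_mod_cast hn0)).2 h1
    rw [le_div_iff₀ hs] at h2
    linarith
  · refine Finset.sum_congr rfl fun n hn => ?_
    congr 1
    apply Set.indicator_of_mem
    simp only [Finset.mem_range, Set.mem_Ici] at hn ⊢
    have h2 : (n:ℝ) ≤ u/s := (Nat.le_floor_iff (by positivity)).1 (by omega)
    rw [le_div_iff₀ hs] at h2
    linarith

lemma floor_succ_div : Tendsto (fun x : ℝ => ((⌊x⌋₊ : ℝ) + 1) / x) atTop (nhds 1) := by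
  have := (tendsto_nat_floor_div_atTop (R := ℝ)).add (tendsto_inv_atTop_zero (𝕜 := ℝ))
  rw [add_zero] at this
  refine this.congr fun x => ?_
  rw [add_div, one_div]

lemma log_ratio {f g : ℝ → ℝ} (hf : ∀ᶠ x in atTop, 0 < f x) (hg : ∀ᶠ x in atTop, 0 < g x)
    (h : Tendsto (fun x => f x / g x) atTop (nhds 1)) :
    Tendsto (fun x => Real.log (f x) - Real.log (g x)) atTop (nhds 0) := by
  have h3 := (Real.continuousAt_log (one_ne_zero)).tendsto.comp h
  rw [Real.log_one] at h3
  refine h3.congr' ?_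
  filter_upwards [hf, hg] with x h1 h2
  simp only [Function.comp]
  rw [Real.log_div h1.ne' h2.ne']

lemma loglog_ratio {f g : ℝ → ℝ} (hf : Tendsto f atTop atTop) (hg : Tendsto g atTop atTop)
    (h : Tendsto (fun x => f x / g x) atTop (nhds 1)) :
    Tendsto (fun x => Real.log (Real.log (f x)) - Real.log (Real.log (g x))) atTop (nhds 0) := by
  have h1 := log_ratio (hf.eventually_gt_atTop 0) (hg.eventually_gt_atTop 0) h
  have lf := Real.tendsto_log_atTop.comp hf
  have lg := Real.tendsto_log_atTop.comp hg
  apply log_ratio (f := fun x => Real.log (f x)) (g := fun x => Real.log (g x)) (lf.eventually_gt_atTop 0) (lg.eventually_gt_atTop 0)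
  have h2 := (h1.mul (tendsto_inv_atTop_zero.comp lg)).add_const 1
  rw [mul_zero, zero_add] at h2
  refine h2.congr' ?_
  filter_upwards [lg.eventually_gt_atTop 0] with x hx
  simp only [Function.comp] at hx ⊢
  field_simp
  ring

lemma floor_succ_tendsto : Tendsto (fun x : ℝ => (⌊x⌋₊ : ℝ) + 1) atTop atTop :=
  tendsto_atTop_mono (fun x => (Nat.lt_floor_add_one x).le) tendsto_id

lemma mD_tendsto {c : ℝ} (hc : Tendsto (fun N : ℕ => ∑ n ∈ Finset.range N, mg n - Real.log (Real.log N)) atTop (nhds c)) :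
    Tendsto mD atTop (nhds (c - Real.eulerMascheroniConstant)) := by
  have hfl : Tendsto (fun t : ℝ => ⌊t⌋₊) atTop atTop := tendsto_nat_floor_atTop
  have h1 := hc.comp ((tendsto_add_atTop_nat 1).comp (hfl.comp Real.tendsto_exp_atTop))
  have h2 := Real.tendsto_eulerMascheroniSeq.comp hfl
  have h3 := (loglog_ratio floor_succ_tendsto tendsto_id floor_succ_div).comp Real.tendsto_exp_atTop
  have h4 := log_ratio (floor_succ_tendsto.eventually_gt_atTop 0) (eventually_gt_atTop 0) floor_succ_div
  have h := ((h1.sub h2).add h3).sub h4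
  rw [add_zero, sub_zero] at h
  refine h.congr fun t => ?_
  simp only [Function.comp, Real.eulerMascheroniSeq, mD, id, Real.log_exp]
  have : ((harmonic ⌊t⌋₊ : ℚ) : ℝ) = ∑ n ∈ Finset.range (⌊t⌋₊ + 1), 1 / (n:ℝ) := by
    rw [Finset.sum_range_succ', harmonic]
    push_cast
    simp
  rw [this]
  push_cast
  ring

lemma mD_measurable : Measurable mD := by
  unfold mD
  apply Measurable.sub
  · exact (measurable_from_top (f := fun N : ℕ => ∑ n ∈ Finset.range (N + 1), mg n)).comp
      (Nat.measurable_floor.comp Real.measurable_exp)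
  · exact (measurable_from_top (f := fun N : ℕ => ∑ n ∈ Finset.range (N + 1), 1 / (n:ℝ))).comp
      Nat.measurable_floor

lemma mD_bounded {L : ℝ} (h : Tendsto mD atTop (nhds L)) : ∃ B, ∀ t, |mD t| ≤ B := by
  have h1 := h.abs.eventually_le_const (lt_add_one |L|)
  obtain ⟨T, hT⟩ := eventually_atTop.1 h1
  set A := ∑ n ∈ Finset.range (⌊Real.exp T⌋₊ + 1), mg n
  set B := ∑ n ∈ Finset.range (⌊T⌋₊ + 1), 1 / (n:ℝ)
  have hA : 0 ≤ A := Finset.sum_nonneg fun n _ => (mg_bound n).1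
  have hB : 0 ≤ B := Finset.sum_nonneg fun n _ => by positivity
  refine ⟨|L| + 1 + A + B, fun t => ?_⟩
  rcases le_total T t with ht | ht
  · linarith [hT t ht]
  · have a1 : ∑ n ∈ Finset.range (⌊Real.exp t⌋₊ + 1), mg n ≤ A := by
      apply Finset.sum_le_sum_of_subset_of_nonneg
      · apply Finset.range_mono
        have := Nat.floor_mono (Real.exp_le_exp.2 ht)
        simpa using this
      · intro n _ _; exact (mg_bound n).1
    have a2 : ∑ n ∈ Finset.range (⌊t⌋₊ + 1), 1 / (n:ℝ) ≤ B := by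
      apply Finset.sum_le_sum_of_subset_of_nonneg
      · apply Finset.range_mono
        have := Nat.floor_mono ht
        simpa using this
      · intro n _ _; positivity
    have a3 : 0 ≤ ∑ n ∈ Finset.range (⌊Real.exp t⌋₊ + 1), mg n := Finset.sum_nonneg fun n _ => (mg_bound n).1
    have a4 : 0 ≤ ∑ n ∈ Finset.range (⌊t⌋₊ + 1), 1 / (n:ℝ) := Finset.sum_nonneg fun n _ => by positivity
    have := abs_nonneg L
    rw [mD, abs_le]
    constructor <;> linarith

open MeasureTheory in
lemma mD_abel {L : ℝ} (h : Tendsto mD atTop (nhds L)) :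
    Tendsto (fun s : ℝ => ∫ u in Set.Ioi 0, mD (u / s) * Real.exp (-u)) (nhdsWithin 0 (Set.Ioi 0)) (nhds L) := by
  obtain ⟨B, hB⟩ := mD_bounded h
  have e : L = ∫ u in Set.Ioi (0:ℝ), L * Real.exp (-u) := by
    rw [integral_const_mul, integral_exp_neg_Ioi]; simp
  conv => rhs; rw [e]
  apply tendsto_integral_filter_of_dominated_convergence (fun u => B * Real.exp (-u))
  · refine Eventually.of_forall fun s => ?_
    apply Measurable.aestronglyMeasurable
    exact (mD_measurable.comp (measurable_id.div_const s)).mul (Real.measurable_exp.comp measurable_neg)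
  · refine Eventually.of_forall fun s => Eventually.of_forall fun u => ?_
    rw [norm_mul, Real.norm_eq_abs, Real.norm_eq_abs, abs_of_pos (Real.exp_pos _)]
    exact mul_le_mul_of_nonneg_right (hB _) (Real.exp_pos _).le
  · exact (integrableOn_exp_neg_Ioi 0).const_mul B
  · filter_upwards [ae_restrict_mem measurableSet_Ioi] with u hu
    have hu : 0 < u := hu
    apply Tendsto.mul_const
    apply h.comp
    exact (tendsto_inv_nhdsGT_zero (𝕜 := ℝ)).const_mul_atTop hu

lemma exp_ratio : Tendsto (fun s : ℝ => Real.log (1 - Real.exp (-s)) - Real.log s) (nhdsWithin 0 (Set.Ioi 0)) (nhds 0) := by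
  have hd : HasDerivAt (fun s : ℝ => 1 - Real.exp (-s)) 1 0 := by
    have := ((hasDerivAt_neg (0:ℝ)).exp).const_sub 1
    simpa using this
  have h1 := hd.tendsto_slope_zero_right
  have h3 := (Real.continuousAt_log (one_ne_zero)).tendsto.comp h1
  rw [Real.log_one] at h3
  refine h3.congr' ?_
  filter_upwards [self_mem_nhdsWithin] with s hs
  have hs : 0 < s := hs
  have : Real.exp (-s) < 1 := exp_neg_lt_one hs
  have hp : 0 < 1 - Real.exp (-s) := by linarith
  simp only [Function.comp, zero_add, neg_zero, Real.exp_zero, sub_self, sub_zero, smul_eq_mul]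
  rw [Real.log_mul (inv_ne_zero hs.ne') hp.ne', Real.log_inv]
  ring

theorem mertens3 : Tendsto (fun N : ℕ => ∑ n ∈ Finset.range N, mg n - Real.log (Real.log N)) atTop
    (nhds Real.eulerMascheroniConstant) := by
  obtain ⟨c, hc⟩ := mertens2
  have h1 := mD_abel (mD_tendsto hc)
  have h2 := mg_dirichlet.add exp_ratio
  rw [add_zero] at h2
  have h3 : Tendsto (fun s : ℝ => ∫ u in Set.Ioi 0, mD (u / s) * Real.exp (-u)) (nhdsWithin 0 (Set.Ioi 0)) (nhds 0) := by
    refine h2.congr' ?_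
    filter_upwards [self_mem_nhdsWithin] with s hs
    rw [← mD_integral hs]; ring
  have := tendsto_nhds_unique h1 h3
  rwa [show c = Real.eulerMascheroniConstant by linarith] at hc

noncomputable def twinF (p : ℕ) : ℝ :=
  if p.Prime ∧ p ≠ 2 then (p : ℝ) * ((p : ℝ) - 2) / ((p : ℝ) - 1) ^ 2 else 1

lemma twin_tendsto : Tendsto (fun N : ℕ => ∏ p ∈ Finset.range N, twinF p) atTop (nhds twinPrimeConstant) := by
  have hs : Summable (fun p : ℕ => if p.Prime ∧ p ≠ 2 then -(1 / ((p:ℝ) - 1) ^ 2) else 0) := by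
    refine Summable.of_norm_bounded (g := fun n : ℕ => 4 * (1 / (n:ℝ) ^ 2))
      ((Real.summable_one_div_nat_pow.2 (by norm_num)).mul_left _) fun n => ?_
    split_ifs with h
    · have h2 : (2:ℝ) ≤ n := by exact_mod_cast h.1.two_le
      rw [norm_neg, Real.norm_eq_abs, abs_of_nonneg (by positivity), mul_one_div,
        div_le_div_iff₀ (by nlinarith) (by positivity)]
      nlinarith
    · simp
  have hm := Real.multipliable_one_add_of_summable hs
  have e : (fun p : ℕ => 1 + if p.Prime ∧ p ≠ 2 then -(1 / ((p:ℝ) - 1) ^ 2) else 0) = twinF := by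
    ext p
    unfold twinF
    split_ifs with h
    · have h2 : (2:ℝ) ≤ p := by exact_mod_cast h.1.two_le
      have : (p:ℝ) - 1 ≠ 0 := by linarith
      field_simp
      ring
    · simp
  rw [e] at hm
  exact hm.hasProd.tendsto_prod_nat

lemma prod_eq (M : ℕ) (hM : 3 ≤ M) :
    ∏ p ∈ (Finset.range M).filter (fun p => p.Prime ∧ 3 ≤ p), ((p : ℝ) - 2) / (p : ℝ) =
    (∏ p ∈ Finset.range M, twinF p) * Real.exp (-∑ p ∈ Finset.range M, mg p) ^ 2 * 4 := by
  have h4 : (4:ℝ) = ∏ p ∈ Finset.range M, if p = 2 then 4 else 1 := by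
    rw [Finset.prod_ite_eq']
    simp; omega
  rw [h4, ← Finset.sum_neg_distrib, Real.exp_sum, ← Finset.prod_pow, ← Finset.prod_mul_distrib,
    ← Finset.prod_mul_distrib, Finset.prod_filter]
  refine Finset.prod_congr rfl fun p _ => ?_
  unfold twinF mg
  by_cases hp : p.Prime
  · have h2 : (2:ℝ) ≤ p := by exact_mod_cast hp.two_le
    have hpos : (0:ℝ) < 1 - 1 / p := by
      rw [sub_pos, div_lt_one (by linarith)]; linarith
    by_cases h : p = 2
    · subst h
      norm_num
      rw [Real.exp_log (by norm_num)]
      norm_num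
    · have h3 : 3 ≤ p := by have := hp.two_le; omega
      have : (p:ℝ) - 1 ≠ 0 := by linarith
      simp only [hp, h, h3, true_and, if_true, ne_eq, not_false_eq_true, if_false, neg_neg]
      rw [Real.exp_log hpos]
      field_simp
  · have h : p ≠ 2 := fun h => hp (h ▸ Nat.prime_two)
    simp [hp, h]

/-- `EGP_{B₂}(2n) · (ln 2n)² / (2n) → 4·e^{−2γ}·C₂ ≈ 0.83235…` as `n → ∞`:
the estimated number of Goldbach pairs for band `B₂` is asymptotically
`C · 2n/(ln 2n)²`. -/
theorem stmt_11 :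
    Tendsto (fun n : ℕ => EGPB2 n * (Real.log (2 * n)) ^ 2 / (2 * n))
      atTop
      (nhds (4 * Real.exp (-2 * Real.eulerMascheroniConstant) * twinPrimeConstant)) := by
  have hsq : Tendsto (fun n : ℕ => Real.sqrt (2 * n)) atTop atTop :=
    Real.tendsto_sqrt_atTop.comp (tendsto_natCast_atTop_atTop.const_mul_atTop (by norm_num))
  have hM : Tendsto (fun n : ℕ => ⌈Real.sqrt (2 * n)⌉₊) atTop atTop := tendsto_nat_ceil_atTop.comp hsq
  have h1 := mertens3.comp hM
  have h2 := twin_tendsto.comp hM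
  have h3 : Tendsto (fun n : ℕ => Real.log (Real.log ⌈Real.sqrt (2 * n)⌉₊) - Real.log (Real.log (Real.sqrt (2 * n)))) atTop (nhds 0) :=
    (loglog_ratio (f := fun x : ℝ => (⌈x⌉₊ : ℝ)) (g := fun x => x)
      (tendsto_natCast_atTop_atTop.comp tendsto_nat_ceil_atTop) tendsto_id tendsto_nat_ceil_div_atTop).comp hsq
  have h4 := (Real.continuous_exp.tendsto _).comp ((h1.add h3).neg.const_mul 2)
  have h5 := (h2.mul h4).const_mul 4
  have e : 4 * (twinPrimeConstant * Real.exp (2 * -(Real.eulerMascheroniConstant + 0))) =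
      4 * Real.exp (-2 * Real.eulerMascheroniConstant) * twinPrimeConstant := by
    rw [add_zero, show 2 * -Real.eulerMascheroniConstant = -2 * Real.eulerMascheroniConstant by ring]
    ring
  rw [e] at h5
  refine h5.congr' ?_
  filter_upwards [hM.eventually_ge_atTop 3, hsq.eventually_gt_atTop 1, eventually_gt_atTop 0] with n hn hs hn0
  have hn0' : (0:ℝ) < n := by exact_mod_cast hn0
  have hlog : Real.log (2 * n) = 2 * Real.log (Real.sqrt (2 * n)) := by
    rw [Real.log_sqrt (by positivity)]; ring
  have hl : 0 < Real.log (Real.sqrt (2 * n)) := Real.log_pos hs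
  simp only [Function.comp, EGPB2]
  rw [prod_eq _ hn, hlog]
  generalize Real.log (Real.sqrt (2 * n)) = l at *
  generalize ∏ p ∈ Finset.range ⌈Real.sqrt (2 * n)⌉₊, twinF p = T
  generalize ∑ p ∈ Finset.range ⌈Real.sqrt (2 * n)⌉₊, mg p = S
  generalize Real.log (Real.log (⌈Real.sqrt (2 * n)⌉₊ : ℝ)) = R
  rw [show 2 * -(S - R + (R - Real.log l)) = -S + -S + (Real.log l + Real.log l) by ring,
    Real.exp_add, Real.exp_add, Real.exp_add, Real.exp_log hl]
  field_simp
end
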